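/- arXiv:quant-ph/0611020 — 8 statements merged into one kernel-verified Lean document; each statement's English description precedes it below -/
import Mathlib

section
/- Let λ > 0, θ_c > 0 and let μ₊ be the Borel measure on ℝ given by μ₊ = e^{-λ} δ_{θ_c} + Σ_{f=1}^∞ ρ_f(θ) dθ, where for odd f ≥ 1, ρ_f(θ) = e^{-λ} λ^f (θ_c² - θ²)^{(f-1)/2} / ((2θ_c)^f (((f-1)/2)!)²) on [-θ_c, θ_c] (and 0 elsewhere), and for even f ≥ 2, ρ_f(θ) = e^{-λ} λ^f (θ_c + θ)(θ_c² - θ²)^{f/2 - 1} / ((2θ_c)^f (f/2)! ((f/2)-1)!) on [-θ_c, θ_c] (and 0 elsewhere). Then for every real m > 0 with m θ_c < λ, ∫ sin(m θ) dμ₊(θ) = e^{-λ} · (m θ_c / √(λ² - (m θ_c)²)) · sinh(√(λ² - (m θ_c)²)). -/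
open MeasureTheory Real Set

theorem hasSum_of_eq {f g : ℕ → ℝ} {a : ℝ} (h : HasSum g a) (e : ∀ j, f j = g j) : HasSum f a := by
  rwa [funext e]

theorem beta_int (a : ℝ) (p q : ℕ) : ∫ θ in (-a)..a, θ^(2*p) * (a^2-θ^2)^q =
   a^(2*p+2*q+1) * (q.factorial * (2*p).factorial * (p+q).factorial * 2^(2*q+1)) / (p.factorial * (2*p+2*q+1).factorial) := by
  induction q generalizing p with
  | zero =>
    simp only [pow_zero, mul_one, integral_pow, mul_zero, add_zero, Nat.factorial_succ, Nat.factorial_zero]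
    have h : (-a)^(2*p+1) = - a^(2*p+1) := Odd.neg_pow ⟨p, rfl⟩ a
    rw [h]
    have := Nat.factorial_ne_zero p
    have := Nat.factorial_ne_zero (2*p)
    push_cast
    field_simp
    ring
  | succ q ih =>
    have : ∀ θ : ℝ, θ^(2*p) * (a^2-θ^2)^(q+1) = a^2 * (θ^(2*p) * (a^2-θ^2)^q) - θ^(2*(p+1)) * (a^2-θ^2)^q := by
      intro θ; ring
    simp_rw [this]
    rw [intervalIntegral.integral_sub, intervalIntegral.integral_const_mul, ih, ih]
    · rw [show 2*(p+1)+2*q+1 = (2*p+2*q+1)+1+1 by ring, show 2*p+2*(q+1)+1 = (2*p+2*q+1)+1+1 by ring,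
        show p+1+q = p+q+1 by ring, show p+(q+1) = p+q+1 by ring, show 2*(p+1) = 2*p+1+1 by ring]
      simp only [Nat.factorial_succ]
      have := Nat.factorial_ne_zero p
      have := Nat.factorial_ne_zero (2*p+2*q+1)
      push_cast
      field_simp
      ring
    · apply Continuous.intervalIntegrable; fun_prop
    · apply Continuous.intervalIntegrable; fun_prop

theorem sin_hasSum (a m : ℝ) (ha : 0 < a) (hm : 0 < m) (k : ℕ) :
    HasSum (fun j : ℕ => (-1)^j * m^(2*j+1) / (2*j+1).factorial *
      ∫ θ in (-a)..a, θ^(2*(j+1)) * (a^2-θ^2)^k)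
      (∫ θ in (-a)..a, θ * (a^2-θ^2)^k * Real.sin (m*θ)) := by
  have hs := (Real.hasSum_sinh (m*a)).summable.mul_left (a * (a^2)^k)
  have := intervalIntegral.hasSum_integral_of_dominated_convergence (μ := volume) (a := -a) (b := a)
    (f := fun θ => θ * (a^2-θ^2)^k * Real.sin (m*θ))
    (F := fun (j:ℕ) θ => (-1)^j * m^(2*j+1) / (2*j+1).factorial * (θ^(2*(j+1)) * (a^2-θ^2)^k))
    (fun j _ => a * (a^2)^k * ((m*a)^(2*j+1) / (2*j+1).factorial)) ?_ ?_ ?_ ?_ ?_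
  · simpa only [intervalIntegral.integral_const_mul] using this
  · intro n; apply Continuous.aestronglyMeasurable; fun_prop
  · intro n
    refine Filter.Eventually.of_forall fun t ht => ?_
    rw [uIoc_of_le (by linarith)] at ht
    have h1 : |t| ≤ a := abs_le.2 ⟨ht.1.le, ht.2⟩
    have h2 : |a^2 - t^2| ≤ a^2 := by
      have := sq_abs t
      rw [abs_le]; constructor <;> nlinarith [abs_nonneg t]
    rw [Real.norm_eq_abs]
    simp only [abs_mul, abs_div, abs_pow, abs_neg, abs_one, one_pow, one_mul, abs_of_pos hm, Nat.abs_cast]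
    calc m^(2*n+1) / (2*n+1).factorial * (|t|^(2*(n+1)) * |a^2-t^2|^k)
        ≤ m^(2*n+1) / (2*n+1).factorial * (a^(2*(n+1)) * (a^2)^k) := by gcongr
      _ = _ := by ring
  · exact Filter.Eventually.of_forall fun t _ => hs
  · exact intervalIntegrable_const
  · refine Filter.Eventually.of_forall fun t _ => ?_
    refine hasSum_of_eq ((Real.hasSum_sin (m*t)).mul_left (t * (a^2-t^2)^k)) fun j => ?_
    ring

theorem dbl_hasSum (x y : ℝ) (g : ℕ → ℝ) (S : ℝ)
    (hg : ∀ k : ℕ, HasSum (fun j : ℕ => x^k * y^j * (k+j).factorial /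
      (k.factorial * j.factorial * (2*(k+j)+1).factorial)) (g k))
    (hS : HasSum (fun n : ℕ => (x+y)^n / (2*n+1).factorial) S) : HasSum g S := by
  set F : ℕ × ℕ → ℝ := fun p => x^p.1 * y^p.2 * (p.1+p.2).factorial /
      (p.1.factorial * p.2.factorial * (2*(p.1+p.2)+1).factorial) with hF
  have hsum : Summable F := by
    have h := Summable.mul_of_nonneg (Real.summable_pow_div_factorial |x|)
      (Real.summable_pow_div_factorial |y|) (fun n => by positivity) (fun n => by positivity)
    refine Summable.of_norm_bounded h ?_
    rintro ⟨k, j⟩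
    have h1 : ((k+j).factorial : ℝ) ≤ (2*(k+j)+1).factorial := by
      exact_mod_cast Nat.factorial_le (by omega)
    simp only [hF, Real.norm_eq_abs, abs_mul, abs_div, abs_pow, Nat.abs_cast]
    have : (0:ℝ) < (2*(k+j)+1).factorial := by positivity
    calc |x|^k * |y|^j * (k+j).factorial / (k.factorial * j.factorial * (2*(k+j)+1).factorial)
        ≤ |x|^k * |y|^j * (2*(k+j)+1).factorial / (k.factorial * j.factorial * (2*(k+j)+1).factorial) := by gcongr
      _ = _ := by field_simp
  have h2 : HasSum (fun n => ∑ p ∈ Finset.HasAntidiagonal.antidiagonal n, F p) (∑' p, F p) := by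
    have h3 := (Finset.HasAntidiagonal.sigmaAntidiagonalEquivProd (A := ℕ)).hasSum_iff.2 hsum.hasSum
    refine h3.sigma fun n => ?_
    have := hasSum_fintype (fun c : Finset.HasAntidiagonal.antidiagonal n => F c.1)
    rw [Finset.sum_coe_sort (Finset.HasAntidiagonal.antidiagonal n) F] at this
    exact this
  have h4 : (fun n => ∑ p ∈ Finset.HasAntidiagonal.antidiagonal n, F p) = fun n : ℕ => (x+y)^n / (2*n+1).factorial := by
    funext n
    rw [(Commute.all x y).add_pow', Finset.sum_div]
    refine Finset.sum_congr rfl ?_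
    rintro ⟨k, j⟩ h
    obtain rfl := Finset.HasAntidiagonal.mem_antidiagonal.1 h
    have h5 : ((k+j).choose k : ℝ) = (k+j).factorial / (k.factorial * j.factorial) := by
      rw [Nat.cast_add_choose]
    simp only [hF, nsmul_eq_mul, h5]
    have := Nat.factorial_ne_zero (2*(k+j)+1)
    have := Nat.factorial_ne_zero k
    have := Nat.factorial_ne_zero j
    field_simp
  rw [h4] at h2
  rw [hS.unique h2]
  exact hsum.hasSum.prod_fiberwise hg

theorem dens_integral (a m : ℝ) (ha : 0 < a) (r h : ℝ → ℝ) (hh : Continuous h)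
    (h0 : ∀ θ ∈ Icc (-a) a, 0 ≤ h θ) (hr : ∀ θ, r θ = Set.indicator (Icc (-a) a) h θ) :
    ∫ θ, Real.sin (m*θ) ∂(volume.withDensity (fun θ => ENNReal.ofReal (r θ))) =
      ∫ θ in (-a)..a, h θ * Real.sin (m*θ) := by
  obtain rfl : r = Set.indicator (Icc (-a) a) h := funext hr
  rw [integral_withDensity_eq_integral_toReal_smul
    (hh.measurable.indicator measurableSet_Icc).ennreal_ofReal (by simp)]
  rw [intervalIntegral.integral_of_le (by linarith), ← integral_Icc_eq_integral_Ioc,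
    ← integral_indicator measurableSet_Icc]
  congr 1
  funext θ
  by_cases hθ : θ ∈ Icc (-a) a
  · simp [hθ, Set.indicator_of_mem, ENNReal.toReal_ofReal (h0 θ hθ)]
  · simp [hθ, Set.indicator_of_notMem]

theorem dens_mass (a C : ℝ) (ha : 0 < a) (r h : ℝ → ℝ)
    (h0 : ∀ θ ∈ Icc (-a) a, h θ ≤ C) (hr : ∀ θ, r θ = Set.indicator (Icc (-a) a) h θ) :
    (volume.withDensity (fun θ => ENNReal.ofReal (r θ))) univ ≤ ENNReal.ofReal (C * (2*a)) := by
  obtain rfl : r = Set.indicator (Icc (-a) a) h := funext hr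
  rw [withDensity_apply _ MeasurableSet.univ, Measure.restrict_univ]
  calc ∫⁻ θ, ENNReal.ofReal (Set.indicator (Icc (-a) a) h θ)
      ≤ ∫⁻ θ, Set.indicator (Icc (-a) a) (fun _ => ENNReal.ofReal C) θ := by
        apply lintegral_mono
        intro θ
        by_cases hθ : θ ∈ Icc (-a) a
        · simpa [hθ, Set.indicator_of_mem] using ENNReal.ofReal_le_ofReal (h0 θ hθ)
        · simp [hθ, Set.indicator_of_notMem]
    _ = ENNReal.ofReal (C * (2*a)) := by
        rw [lintegral_indicator_const measurableSet_Icc, Real.volume_Icc,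
          ← ENNReal.ofReal_mul' (by linarith)]
        congr 2; ring

theorem odd_int (a : ℝ) (f : ℝ → ℝ) (hf : ∀ x, f (-x) = - f x) : ∫ θ in (-a)..a, f θ = 0 := by
  have := intervalIntegral.integral_comp_neg (a := -a) (b := a) f
  simp only [hf, intervalIntegral.integral_neg, neg_neg] at this
  linarith


/-- The expectation of `sin (m θ)` under the distribution of
time-integrated symmetric two-level telegraph noise started in the positive state. -/
theorem telegraph_positive_start_sin_expectation
    (lam θc : ℝ) (hlam : 0 < lam) (hθc : 0 < θc)
    (ρ : ℕ → ℝ → ℝ)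
    (hρ_odd : ∀ f : ℕ, Odd f → ∀ θ : ℝ, ρ f θ =
      Set.indicator (Set.Icc (-θc) θc)
        (fun θ => Real.exp (-lam) * lam ^ f * (θc ^ 2 - θ ^ 2) ^ ((f - 1) / 2) /
          ((2 * θc) ^ f * ((Nat.factorial ((f - 1) / 2) : ℝ)) ^ 2)) θ)
    (hρ_even : ∀ f : ℕ, Even f → 2 ≤ f → ∀ θ : ℝ, ρ f θ =
      Set.indicator (Set.Icc (-θc) θc)
        (fun θ => Real.exp (-lam) * lam ^ f * (θc + θ) * (θc ^ 2 - θ ^ 2) ^ (f / 2 - 1) /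
          ((2 * θc) ^ f * (Nat.factorial (f / 2) : ℝ) *
            (Nat.factorial (f / 2 - 1) : ℝ))) θ)
    (μ : Measure ℝ)
    (hμ : μ = (ENNReal.ofReal (Real.exp (-lam))) • Measure.dirac θc +
      Measure.sum (fun f : ℕ =>
        volume.withDensity (fun θ => ENNReal.ofReal (ρ (f + 1) θ))))
    (m : ℝ) (hm : 0 < m) (hmθ : m * θc < lam) :
    ∫ θ, Real.sin (m * θ) ∂μ =
      Real.exp (-lam) * (m * θc / Real.sqrt (lam ^ 2 - (m * θc) ^ 2)) *
        Real.sinh (Real.sqrt (lam ^ 2 - (m * θc) ^ 2)) := by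
  obtain ⟨a, rfl⟩ : ∃ a, a = θc := ⟨_, rfl⟩
  set ho : ℕ → ℝ → ℝ := fun k θ => Real.exp (-lam) * lam ^ (2*k+1) * (a ^ 2 - θ ^ 2) ^ k /
          ((2 * a) ^ (2*k+1) * (Nat.factorial k : ℝ) ^ 2) with hho
  set he : ℕ → ℝ → ℝ := fun k θ => Real.exp (-lam) * lam ^ (2*k+2) * (a + θ) * (a ^ 2 - θ ^ 2) ^ k /
          ((2 * a) ^ (2*k+2) * (Nat.factorial (k+1) : ℝ) * (Nat.factorial k : ℝ)) with hhe
  have ro : ∀ k θ, ρ (2*k+1) θ = Set.indicator (Icc (-a) a) (ho k) θ := by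
    intro k θ
    rw [hρ_odd _ ⟨k, rfl⟩]
    simp only [show (2*k+1-1)/2 = k by omega, hho]
  have re : ∀ k θ, ρ (2*k+1+1) θ = Set.indicator (Icc (-a) a) (he k) θ := by
    intro k θ
    rw [hρ_even _ ⟨k+1, by ring⟩ (by omega)]
    simp only [show (2*k+1+1)/2 = k+1 by omega, Nat.add_sub_cancel, hhe]
  have hb : ∀ θ ∈ Icc (-a) a, 0 ≤ a^2 - θ^2 ∧ a^2 - θ^2 ≤ a^2 ∧ 0 ≤ a + θ ∧ a + θ ≤ 2 * a := by
    rintro θ ⟨h1, h2⟩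
    refine ⟨by nlinarith, by nlinarith, by linarith, by linarith⟩
  have ho0 : ∀ k, ∀ θ ∈ Icc (-a) a, 0 ≤ ho k θ := by
    intro k θ hθ
    obtain ⟨h1, h2, h3, h4⟩ := hb θ hθ
    simp only [hho]; positivity
  have he0 : ∀ k, ∀ θ ∈ Icc (-a) a, 0 ≤ he k θ := by
    intro k θ hθ
    obtain ⟨h1, h2, h3, h4⟩ := hb θ hθ
    simp only [hhe]; positivity
  have hfac : ∀ k : ℕ, (1:ℝ) ≤ k.factorial := fun k => by
    exact_mod_cast Nat.succ_le_of_lt k.factorial_pos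
  have hoC : ∀ k, ∀ θ ∈ Icc (-a) a, ho k θ ≤
      Real.exp (-lam) * lam / (2*a) * ((lam^2/4)^k / k.factorial) := by
    intro k θ hθ
    obtain ⟨h1, h2, h3, h4⟩ := hb θ hθ
    calc ho k θ ≤ Real.exp (-lam) * lam ^ (2*k+1) * (a ^ 2) ^ k /
          ((2 * a) ^ (2*k+1) * ((Nat.factorial k : ℝ) * 1)) := by
          simp only [hho, sq (Nat.factorial k : ℝ)]
          gcongr
          exact hfac k
      _ = _ := by
          rw [show (2*a)^(2*k+1) = (4:ℝ)^k * (a^2)^k * (2*a) by rw [pow_succ, pow_mul, mul_pow, mul_pow]; norm_num,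
            show lam^(2*k+1) = (lam^2)^k * lam by rw [pow_succ, pow_mul], div_pow]
          field_simp
  have heC : ∀ k, ∀ θ ∈ Icc (-a) a, he k θ ≤
      Real.exp (-lam) * lam^2 / (2*a) * ((lam^2/4)^k / k.factorial) := by
    intro k θ hθ
    obtain ⟨h1, h2, h3, h4⟩ := hb θ hθ
    calc he k θ ≤ Real.exp (-lam) * lam ^ (2*k+2) * (2*a) * (a ^ 2) ^ k /
          ((2 * a) ^ (2*k+2) * 1 * (Nat.factorial k : ℝ)) := by
          simp only [hhe]
          gcongr
          exact hfac _
      _ = _ := by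
          rw [show (2*a)^(2*k+2) = (4:ℝ)^k * (a^2)^k * (2*a)^2 by rw [pow_add, pow_mul, mul_pow, mul_pow]; norm_num,
            show lam^(2*k+2) = (lam^2)^k * lam^2 by rw [pow_add, pow_mul], div_pow]
          field_simp
  have hfin : IsFiniteMeasure (Measure.sum (fun f : ℕ =>
        volume.withDensity (fun θ => ENNReal.ofReal (ρ (f + 1) θ)))) := by
    constructor
    rw [Measure.sum_apply _ MeasurableSet.univ, ← tsum_even_add_odd ENNReal.summable ENNReal.summable]
    have hs := Real.summable_pow_div_factorial (lam^2/4)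
    refine ENNReal.add_lt_top.2 ⟨?_, ?_⟩
    · refine lt_of_le_of_lt (ENNReal.tsum_le_tsum fun k =>
        dens_mass a _ hθc _ (ho k) (hoC k) (ro k)) ?_
      exact lt_top_iff_ne_top.2 ((hs.mul_left _).mul_right _).tsum_ofReal_ne_top
    · refine lt_of_le_of_lt (ENNReal.tsum_le_tsum fun k =>
        dens_mass a _ hθc _ (he k) (heC k) (re k)) ?_
      exact lt_top_iff_ne_top.2 ((hs.mul_left _).mul_right _).tsum_ofReal_ne_top
  have hint : ∀ ν : Measure ℝ, IsFiniteMeasure ν → Integrable (fun θ => Real.sin (m*θ)) ν := by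
    intro ν _
    refine Integrable.of_bound (Continuous.aestronglyMeasurable (by fun_prop)) 1
      (Filter.Eventually.of_forall fun θ => Real.abs_sin_le_one _)
  have hH := hasSum_integral_measure (hint _ hfin)
  rw [hμ, integral_add_measure ((hint _ inferInstance).smul_measure ENNReal.ofReal_ne_top) (hint _ hfin), integral_smul_measure,
    integral_dirac, ENNReal.toReal_ofReal (Real.exp_pos _).le, smul_eq_mul]
  set I := ∫ θ, Real.sin (m * θ) ∂(Measure.sum (fun f : ℕ =>
        volume.withDensity (fun θ => ENNReal.ofReal (ρ (f + 1) θ)))) with hI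
  have hodd : ∀ k : ℕ, ∫ θ, Real.sin (m * θ) ∂(volume.withDensity (fun θ => ENNReal.ofReal (ρ (2*k + 1) θ))) = 0 := by
    intro k
    rw [dens_integral a m hθc _ (ho k) (by simp only [hho]; fun_prop) (ho0 k) (ro k)]
    apply odd_int
    intro x
    simp [hho, Real.sin_neg]
  have heven : ∀ k : ℕ, ∫ θ, Real.sin (m * θ) ∂(volume.withDensity (fun θ => ENNReal.ofReal (ρ (2*k + 1 + 1) θ))) =
      Real.exp (-lam) * lam ^ (2*k+2) / ((2 * a) ^ (2*k+2) * (Nat.factorial (k+1) : ℝ) * (Nat.factorial k : ℝ)) *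
      ∫ θ in (-a)..a, θ * (a^2-θ^2)^k * Real.sin (m*θ) := by
    intro k
    rw [dens_integral a m hθc _ (he k) (by simp only [hhe]; fun_prop) (he0 k) (re k)]
    have h1 : ∫ θ in (-a)..a, a * (a^2-θ^2)^k * Real.sin (m*θ) = 0 := by
      apply odd_int
      intro x
      simp [Real.sin_neg]
    have h2 : ∫ θ in (-a)..a, θ * (a^2-θ^2)^k * Real.sin (m*θ) =
        ∫ θ in (-a)..a, (a * (a^2-θ^2)^k * Real.sin (m*θ) + θ * (a^2-θ^2)^k * Real.sin (m*θ)) := by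
      rw [intervalIntegral.integral_add, h1, zero_add]
      · apply Continuous.intervalIntegrable; fun_prop
      · apply Continuous.intervalIntegrable; fun_prop
    rw [h2, ← intervalIntegral.integral_const_mul]
    congr 1
    funext θ
    simp only [hhe]
    ring
  have hH2 : HasSum (fun k : ℕ => ∫ θ, Real.sin (m * θ) ∂(volume.withDensity (fun θ => ENNReal.ofReal (ρ (2*k + 1 + 1) θ)))) I := by
    have hinj : Function.Injective (fun k : ℕ => 2*k+1) := fun x y h => by
      simp only at h; omega
    refine (hinj.hasSum_iff ?_).2 hH
    intro x hx
    rcases Nat.even_or_odd' x with ⟨k, rfl | rfl⟩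
    · exact hodd k
    · exact absurd ⟨k, rfl⟩ hx
  set s := Real.sqrt (lam ^ 2 - (m * a) ^ 2) with hs
  have hM : 0 < m * a := mul_pos hm hθc
  have hpos : 0 < lam ^ 2 - (m * a) ^ 2 := by nlinarith
  have hs0 : 0 < s := Real.sqrt_pos.2 hpos
  have hss : s^2 = lam^2 + -(m*a)^2 := by rw [hs, Real.sq_sqrt hpos.le]; ring
  set E := Real.exp (-lam) with hE
  have hE0 : 0 < E := Real.exp_pos _
  set g : ℕ → ℝ := fun k => match k with
    | 0 => Real.sin (m*a) / (m*a)
    | k+1 => (∫ θ, Real.sin (m * θ) ∂(volume.withDensity (fun θ => ENNReal.ofReal (ρ (2*k + 1 + 1) θ)))) / (E * (m*a)) with hg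
  have hgS : HasSum g (Real.sinh s / s) := by
    refine dbl_hasSum (lam^2) (-(m*a)^2) g _ ?_ ?_
    · intro k
      cases k with
      | zero =>
        refine hasSum_of_eq ((Real.hasSum_sin (m*a)).div_const (m*a)) fun j => ?_
        have := Nat.factorial_ne_zero j
        rw [neg_pow, ← pow_mul]
        simp only [pow_zero, zero_add, Nat.factorial_zero]
        field_simp
        simp
        ring
      | succ k =>
        simp only [hg, heven]
        refine hasSum_of_eq (((sin_hasSum a m hθc hm k).mul_left (E * lam ^ (2*k+2) / ((2 * a) ^ (2*k+2) * (Nat.factorial (k+1) : ℝ) * (Nat.factorial k : ℝ)))).div_const (E * (m*a))) fun j => ?_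
        rw [beta_int, neg_pow, ← pow_mul, ← pow_mul]
        rw [show 2*(j+1) + 2*k+1 = 2*(k+1+j)+1 by ring, show j+1+k = k+1+j by ring,
          show 2*(j+1) = (2*j+1)+1 by ring, Nat.factorial_succ (2*j+1), Nat.factorial_succ j]
        have := Nat.factorial_ne_zero j
        have := Nat.factorial_ne_zero k
        have := Nat.factorial_ne_zero (k+1)
        have := Nat.factorial_ne_zero (2*j+1)
        have := Nat.factorial_ne_zero (2*(k+1+j)+1)
        push_cast
        field_simp
        ring
    · refine hasSum_of_eq ((Real.hasSum_sinh s).div_const s) fun n => ?_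
      rw [← hss]
      field_simp
      ring
  have h1 := (hasSum_nat_add_iff' 1).2 hgS
  have h2 := (hH2.div_const (E * (m*a))).unique h1
  simp only [Finset.range_one, Finset.sum_singleton, hg] at h2
  field_simp at h2 ⊢
  linarith
end

section
/- For every even natural number m ≥ 2, every odd natural number f ≥ 1, and every real θ_c > 0, (f! / ((2θ_c)^f (((f-1)/2)!)²)) · ∫_{-θ_c}^{θ_c} (θ_c² - θ²)^{(f-1)/2} θ^m dθ = θ_c^m · (1·3·5···(m-1)) / ((f+2)(f+4)···(f+m)). -/
open Real Finset

lemma tel_sub (c : ℝ) (n j : ℕ) :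
    (∫ θ in (-c)..c, (c ^ 2 - θ ^ 2) ^ (n + 1) * θ ^ (2 * j)) =
      c ^ 2 * (∫ θ in (-c)..c, (c ^ 2 - θ ^ 2) ^ n * θ ^ (2 * j)) -
      ∫ θ in (-c)..c, (c ^ 2 - θ ^ 2) ^ n * θ ^ (2 * (j + 1)) := by
  rw [← intervalIntegral.integral_const_mul, ← intervalIntegral.integral_sub]
  · congr 1
    ext θ
    ring
  · exact Continuous.intervalIntegrable (by fun_prop) _ _
  · exact Continuous.intervalIntegrable (by fun_prop) _ _

lemma tel_parts (c : ℝ) (n j : ℕ) :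
    (2 * (j : ℝ) + 1) * (∫ θ in (-c)..c, (c ^ 2 - θ ^ 2) ^ (n + 1) * θ ^ (2 * j)) =
      2 * ((n : ℝ) + 1) * ∫ θ in (-c)..c, (c ^ 2 - θ ^ 2) ^ n * θ ^ (2 * (j + 1)) := by
  rw [← sub_eq_zero, ← intervalIntegral.integral_const_mul, ← intervalIntegral.integral_const_mul,
    ← intervalIntegral.integral_sub]
  · rw [intervalIntegral.integral_eq_sub_of_hasDerivAt
      (f := fun θ : ℝ => (c ^ 2 - θ ^ 2) ^ (n + 1) * θ ^ (2 * j + 1))]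
    · simp
    · intro x _
      have h := ((((hasDerivAt_id x).pow 2).const_sub (c ^ 2)).pow (n + 1)).mul
        ((hasDerivAt_id x).pow (2 * j + 1))
      refine h.congr_deriv ?_
      simp
      ring
    · exact Continuous.intervalIntegrable (by fun_prop) _ _
  · exact Continuous.intervalIntegrable (by fun_prop) _ _
  · exact Continuous.intervalIntegrable (by fun_prop) _ _

lemma tel_step (c : ℝ) (n j : ℕ) :
    (2 * (n : ℝ) + 1 + 2 * ((j : ℝ) + 1)) *
      (∫ θ in (-c)..c, (c ^ 2 - θ ^ 2) ^ n * θ ^ (2 * (j + 1))) =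
    (2 * (j : ℝ) + 1) * c ^ 2 * ∫ θ in (-c)..c, (c ^ 2 - θ ^ 2) ^ n * θ ^ (2 * j) := by
  have h1 := tel_sub c n j
  have h2 := tel_parts c n j
  rw [h1] at h2
  linear_combination -h2

lemma tel_norm (c : ℝ) (n : ℕ) :
    (Nat.factorial (2 * n + 1) : ℝ) * (∫ θ in (-c)..c, (c ^ 2 - θ ^ 2) ^ n * θ ^ (2 * 0)) =
      (2 * c) ^ (2 * n + 1) * (Nat.factorial n : ℝ) ^ 2 := by
  induction n with
  | zero => simp; ring
  | succ n ih =>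
    have h1 := tel_step c n 0
    have h2 := tel_parts c n 0
    rw [show 2 * (n + 1) + 1 = (2 * n + 1) + 1 + 1 by ring, Nat.factorial_succ (2 * n + 1 + 1),
      Nat.factorial_succ (2 * n + 1), Nat.factorial_succ n]
    push_cast at h1 h2 ⊢
    linear_combination (2 * (n : ℝ) + 3) * (2 * n + 2) * (Nat.factorial (2 * n + 1) : ℝ) * h2
      + (2 * (n : ℝ) + 2) ^ 2 * (Nat.factorial (2 * n + 1) : ℝ) * h1
      + (2 * (n : ℝ) + 2) ^ 2 * c ^ 2 * ih

lemma tel_moment (c : ℝ) (n j : ℕ) :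
    (∏ k ∈ Finset.range j, (2 * (n : ℝ) + 1 + 2 * ((k : ℝ) + 1))) *
      (∫ θ in (-c)..c, (c ^ 2 - θ ^ 2) ^ n * θ ^ (2 * j)) =
    c ^ (2 * j) * (∏ k ∈ Finset.range j, (2 * (k : ℝ) + 1)) *
      ∫ θ in (-c)..c, (c ^ 2 - θ ^ 2) ^ n * θ ^ (2 * 0) := by
  induction j with
  | zero => simp
  | succ j ih =>
    have h := tel_step c n j
    rw [Finset.prod_range_succ, Finset.prod_range_succ, mul_assoc, h]
    linear_combination (2 * (j : ℝ) + 1) * c ^ 2 * ih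

/-- The `m`-th moment of the density of time-integrated symmetric
telegraph noise conditioned on an odd number `f` of flips. -/
theorem telegraph_odd_flip_even_moment
    (m f : ℕ) (hm : Even m) (hm2 : 2 ≤ m) (hf : Odd f) (θc : ℝ) (hθc : 0 < θc) :
    (Nat.factorial f : ℝ) / ((2 * θc) ^ f * ((Nat.factorial ((f - 1) / 2) : ℝ)) ^ 2) *
      ∫ θ in (-θc)..θc, (θc ^ 2 - θ ^ 2) ^ ((f - 1) / 2) * θ ^ m =
    θc ^ m * (∏ k ∈ Finset.range (m / 2), (2 * (k : ℝ) + 1)) /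
      ∏ k ∈ Finset.range (m / 2), ((f : ℝ) + 2 * ((k : ℝ) + 1)) := by
  obtain ⟨n, rfl⟩ := hf
  obtain ⟨j, rfl⟩ := hm.two_dvd
  rw [show (2 * n + 1 - 1) / 2 = n by omega, show 2 * j / 2 = j by omega]
  have h1 := tel_norm θc n
  have h2 := tel_moment θc n j
  have hP : (∏ k ∈ Finset.range j, (2 * (n : ℝ) + 1 + 2 * ((k : ℝ) + 1))) ≠ 0 :=
    Finset.prod_ne_zero_iff.mpr fun k _ => by positivity
  have hD : (2 * θc) ^ (2 * n + 1) * (Nat.factorial n : ℝ) ^ 2 ≠ 0 := by positivity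
  push_cast
  rw [div_mul_eq_mul_div, div_eq_div_iff hD hP, ← h1]
  linear_combination (Nat.factorial (2 * n + 1) : ℝ) * h2
end

section
/- For every real λ > 0, e^{-λ} · (1 + Σ_{n=0}^∞ (1/(2n+3)) · (λ^{2n+1}/(2n+1)! + λ^{2n+2}/(2n+2)!)) = 1/λ + (e^{-2λ} - 1)/(2λ²). -/
open Real

/-- The Poisson-weighted sum of conditional second moments of
time-integrated symmetric telegraph noise equals the closed form of the variance
(with the common factor `θ_c²` removed). -/
theorem telegraph_variance_series
    (lam : ℝ) (hlam : 0 < lam) :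
    Real.exp (-lam) * (1 + ∑' n : ℕ, (1 / (2 * (n : ℝ) + 3)) *
      (lam ^ (2 * n + 1) / (Nat.factorial (2 * n + 1) : ℝ) +
        lam ^ (2 * n + 2) / (Nat.factorial (2 * n + 2) : ℝ))) =
    1 / lam + (Real.exp (-2 * lam) - 1) / (2 * lam ^ 2) := by
  have hne : lam ≠ 0 := hlam.ne'
  have hC := (hasSum_nat_add_iff' 1).mpr (Real.hasSum_cosh lam)
  have hS := (hasSum_nat_add_iff' 1).mpr (Real.hasSum_sinh lam)
  have h := ((hC.mul_left (1 / lam)).sub (hS.mul_left (1 / lam ^ 2))).add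
    (hS.mul_left (1 / lam))
  have hterm : ∀ n : ℕ, (1 / (2 * (n : ℝ) + 3)) *
      (lam ^ (2 * n + 1) / (Nat.factorial (2 * n + 1) : ℝ) +
        lam ^ (2 * n + 2) / (Nat.factorial (2 * n + 2) : ℝ)) =
      1 / lam * (lam ^ (2 * (n + 1)) / (Nat.factorial (2 * (n + 1)) : ℝ)) -
      1 / lam ^ 2 * (lam ^ (2 * (n + 1) + 1) / (Nat.factorial (2 * (n + 1) + 1) : ℝ)) +
      1 / lam * (lam ^ (2 * (n + 1) + 1) / (Nat.factorial (2 * (n + 1) + 1) : ℝ)) := by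
    intro n
    have e1 : 2 * (n + 1) = 2 * n + 1 + 1 := by ring
    have e2 : 2 * n + 2 = 2 * n + 1 + 1 := by ring
    have hf : (Nat.factorial (2 * n + 1) : ℝ) ≠ 0 := by positivity
    have h2 : (2 * (n : ℝ) + 1 + 1) ≠ 0 := by positivity
    have h3 : (2 * (n : ℝ) + 1 + 1 + 1) ≠ 0 := by positivity
    have e3 : (2 * (n : ℝ) + 3) = 2 * (n : ℝ) + 1 + 1 + 1 := by ring
    rw [e1, e2, Nat.factorial_succ (2 * n + 1 + 1), Nat.factorial_succ (2 * n + 1), e3]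
    push_cast
    simp only [pow_succ _ (2 * n + 1 + 1), pow_succ _ (2 * n + 1)]
    generalize lam ^ (2 * n + 1) = p
    field_simp
    ring
  rw [tsum_congr hterm, h.tsum_eq]
  have he : Real.exp (-2 * lam) = Real.exp (-lam) * Real.exp (-lam) := by
    rw [← Real.exp_add]; ring_nf
  have hm : Real.exp lam * Real.exp (-lam) = 1 := by
    rw [← Real.exp_add]; simp
  rw [he, Real.cosh_eq, Real.sinh_eq]
  simp
  generalize Real.exp (-lam) = b at *
  generalize Real.exp lam = a at *
  field_simp
  linear_combination (2 * lam - 1) * hm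
end

section
/- Let j_n denote the spherical Bessel function of the first kind, defined for an integer n ≥ 0 by the everywhere-convergent series j_n(x) = 2^n x^n Σ_{s=0}^∞ (-1)^s (s+n)! x^{2s} / (s! (2s+2n+1)!), and set j_{-1}(z) = cos(z)/z for z ≠ 0. Then for every real z ≠ 0 and every real t with z² - 2zt ≥ 0, Σ_{n=0}^∞ (t^n / n!) · j_{n-1}(z) = (1/z) · cos(√(z² - 2zt)). -/
open Real

/-- The spherical Bessel function of the first kind `j_n`, defined by its
everywhere-convergent power series. -/
noncomputable def sphericalBesselJ (n : ℕ) (x : ℝ) : ℝ :=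
  2 ^ n * x ^ n * ∑' s : ℕ,
    (-1) ^ s * (Nat.factorial (s + n) : ℝ) * x ^ (2 * s) /
      ((Nat.factorial s : ℝ) * (Nat.factorial (2 * s + 2 * n + 1) : ℝ))

/-- `j_{n-1}` for `n : ℕ`, with the convention `j_{-1}(z) = cos z / z`. -/
noncomputable def sphericalBesselJPred (n : ℕ) (z : ℝ) : ℝ :=
  match n with
  | 0 => Real.cos z / z
  | k + 1 => sphericalBesselJ k z

/-- The double-series term. -/
noncomputable def sbTerm (z t : ℝ) (p : ℕ × ℕ) : ℝ :=
  (-1) ^ p.2 * ((p.2 + p.1).factorial : ℝ) * z ^ (2 * p.2) * (2 * z * t) ^ p.1 /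
    ((p.2.factorial : ℝ) * (p.1.factorial : ℝ) * ((2 * (p.2 + p.1)).factorial : ℝ))

lemma sbTerm_summable (z t : ℝ) : Summable (sbTerm z t) := by
  have h1 := Real.summable_pow_div_factorial (z ^ 2)
  have h2 := Real.summable_pow_div_factorial (|2 * z * t|)
  have h3 := h2.mul_of_nonneg h1 (fun n => by positivity) (fun n => by positivity)
  refine Summable.of_norm_bounded h3 ?_
  rintro ⟨n, s⟩
  have hle : ((s + n).factorial : ℝ) ≤ ((2 * (s + n)).factorial : ℝ) := by
    exact_mod_cast Nat.factorial_le (by omega)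
  have e : ‖sbTerm z t (n, s)‖ = (|2 * z * t| ^ n / n.factorial * ((z ^ 2) ^ s / s.factorial))
      * (((s + n).factorial : ℝ) / ((2 * (s + n)).factorial : ℝ)) := by
    simp only [sbTerm, norm_div, norm_mul, norm_pow, norm_neg, norm_one, one_pow,
      Real.norm_eq_abs, pow_mul, sq_abs, Nat.abs_cast, abs_mul, mul_pow]
    field_simp
  rw [e]
  apply mul_le_of_le_one_right (by positivity)
  exact (div_le_one (by positivity)).2 hle

lemma sbTerm_antidiagonal (z t : ℝ) (m : ℕ) :
    ∑ p ∈ Finset.HasAntidiagonal.antidiagonal m, sbTerm z t p =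
      (-1) ^ m * (z ^ 2 - 2 * z * t) ^ m / ((2 * m).factorial : ℝ) := by
  have e : z ^ 2 - 2 * z * t = (-(2 * z * t)) + z ^ 2 := by ring
  rw [e, (Commute.all _ _).add_pow', Finset.mul_sum, Finset.sum_div]
  refine Finset.sum_congr rfl ?_
  rintro ⟨n, s⟩ hp
  rw [Finset.HasAntidiagonal.mem_antidiagonal] at hp
  simp only at hp
  subst hp
  have hc : (((n + s).choose n : ℕ) : ℝ) = (n + s).factorial / (n.factorial * s.factorial) := by
    rw [Nat.cast_add_choose]
  simp only [sbTerm, nsmul_eq_mul, hc, neg_pow (2 * z * t), pow_add, ← pow_mul]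
  rw [add_comm s n]
  have h1 : ((-1 : ℝ) ^ n) * (-1) ^ n = 1 := by rw [← mul_pow]; simp
  field_simp
  linear_combination (-(z ^ (s * 2) * z ^ n * t ^ n * 2 ^ n)) * h1

theorem sphericalBessel_generating_cos
    (z t : ℝ) (hz : z ≠ 0) (h : 0 ≤ z ^ 2 - 2 * z * t) :
    ∑' n : ℕ, t ^ n / (Nat.factorial n : ℝ) * sphericalBesselJPred n z =
      (1 / z) * Real.cos (Real.sqrt (z ^ 2 - 2 * z * t)) := by
  have hs := sbTerm_summable z t
  have hR : ∑' p, sbTerm z t p = Real.cos (Real.sqrt (z ^ 2 - 2 * z * t)) := by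
    rw [← Finset.HasAntidiagonal.sigmaAntidiagonalEquivProd.tsum_eq (sbTerm z t)]
    have hs' := (Finset.HasAntidiagonal.sigmaAntidiagonalEquivProd (A := ℕ)).summable_iff.2 hs
    refine (Summable.tsum_sigma' (fun m => (hasSum_fintype _).summable) hs').trans ?_
    rw [Real.cos_eq_tsum]
    refine tsum_congr fun m => ?_
    rw [pow_mul, Real.sq_sqrt h, ← sbTerm_antidiagonal, tsum_fintype]
    exact Finset.sum_coe_sort (Finset.HasAntidiagonal.antidiagonal m) (sbTerm z t)
  rw [← hR, hs.tsum_prod, ← tsum_mul_left]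
  refine tsum_congr fun n => ?_
  cases n with
  | zero =>
    simp only [sphericalBesselJPred, Real.cos_eq_tsum z]
    have : ∀ s : ℕ, sbTerm z t (0, s) = (-1) ^ s * z ^ (2 * s) / ((2 * s).factorial : ℝ) := by
      intro s
      simp only [sbTerm, add_zero, pow_zero, Nat.factorial_zero, Nat.cast_one]
      field_simp
    simp only [this]
    simp
    ring
  | succ k =>
    simp only [sphericalBesselJPred, sphericalBesselJ]
    rw [← mul_assoc, ← tsum_mul_left, ← tsum_mul_left]
    refine tsum_congr fun s => ?_
    have h1 : ((s + (k + 1)).factorial : ℝ) = (s + k + 1) * (s + k).factorial := by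
      rw [← add_assoc, Nat.factorial_succ]; push_cast; ring
    have h2 : ((2 * (s + (k + 1))).factorial : ℝ)
        = 2 * (s + k + 1) * (2 * s + 2 * k + 1).factorial := by
      rw [show 2 * (s + (k + 1)) = (2 * s + 2 * k + 1) + 1 by ring, Nat.factorial_succ]
      push_cast; ring
    simp only [sbTerm]
    rw [h1, h2]
    have h3 : (s : ℝ) + k + 1 ≠ 0 := by positivity
    field_simp
    try ring
end

section
/- Let λ > 0, θ_c > 0 and let μ be the Borel measure on ℝ given by μ = e^{-λ} (δ_{θ_c} + δ_{-θ_c})/2 + e^{-λ} Σ_{n=0}^∞ (λ^{2n+1}/(2n+1)! + λ^{2n+2}/(2n+2)!) · d_{2n+1}(θ) dθ, where for odd f, d_f(θ) = f! (θ_c² - θ²)^{(f-1)/2} / ((2θ_c)^f (((f-1)/2)!)²) on [-θ_c, θ_c] (and 0 elsewhere). Then for every real m > 0 with m θ_c < λ, setting v = √(1 - (m θ_c/λ)²), one has ∫ cos(m θ) dμ(θ) = e^{-λ} (cosh(λ v) + sinh(λ v)/v). -/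
open MeasureTheory Real Set

lemma tele_moment_rec (c : ℝ) (j k : ℕ) :
    (2 * (j + k : ℝ) + 3) * ∫ t in (-c)..c, t ^ (2 * j) * (c ^ 2 - t ^ 2) ^ (k + 1) =
      2 * (k + 1) * c ^ 2 * ∫ t in (-c)..c, t ^ (2 * j) * (c ^ 2 - t ^ 2) ^ k := by
  have hI : ∀ f : ℝ → ℝ, Continuous f → IntervalIntegrable f volume (-c) c :=
    fun f hf => hf.intervalIntegrable _ _
  have hder : ∀ t ∈ uIcc (-c) c, HasDerivAt (fun t : ℝ => t ^ (2 * j + 1) * (c ^ 2 - t ^ 2) ^ (k + 1))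
      ((2 * (j + k : ℝ) + 3) * (t ^ (2 * j) * (c ^ 2 - t ^ 2) ^ (k + 1)) -
        2 * (k + 1) * c ^ 2 * (t ^ (2 * j) * (c ^ 2 - t ^ 2) ^ k)) t := by
    intro t _
    have h1 : HasDerivAt (fun t : ℝ => t ^ (2 * j + 1)) (((2 * j + 1 : ℕ) : ℝ) * t ^ (2 * j)) t := by
      simpa using hasDerivAt_pow (2 * j + 1) t
    have h2 : HasDerivAt (fun t : ℝ => c ^ 2 - t ^ 2) (-(2 * t)) t := by
      simpa using (hasDerivAt_pow 2 t).const_sub (c ^ 2)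
    have h3 := h1.mul (h2.pow (k + 1))
    refine h3.congr_deriv ?_
    simp only [Pi.pow_apply, Nat.add_sub_cancel]
    push_cast
    ring
  have := intervalIntegral.integral_eq_sub_of_hasDerivAt hder (hI _ (by fun_prop))
  rw [intervalIntegral.integral_sub (hI _ (by fun_prop)) (hI _ (by fun_prop)),
    intervalIntegral.integral_const_mul, intervalIntegral.integral_const_mul] at this
  simp at this
  linarith

lemma tele_moment (c : ℝ) (j k : ℕ) :
    ∫ t in (-c)..c, t ^ (2 * j) * (c ^ 2 - t ^ 2) ^ k =
      c ^ (2 * (j + k) + 1) * 2 ^ (2 * k + 1) * k.factorial * (2 * j).factorial *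
        (j + k).factorial / (j.factorial * (2 * (j + k) + 1).factorial) := by
  induction k with
  | zero =>
    simp only [pow_zero, mul_one, integral_pow, add_zero, Nat.factorial_zero, Nat.factorial_succ]
    have := Nat.factorial_ne_zero (2 * j)
    have := Nat.factorial_ne_zero j
    rw [Odd.neg_pow (by simp)]
    push_cast
    field_simp
    ring
  | succ k ih =>
    have h := tele_moment_rec c j k
    rw [ih] at h
    have h3 : (2 * (j + k : ℝ) + 3) ≠ 0 := by positivity
    apply mul_left_cancel₀ h3
    rw [h]
    have e1 : (j + (k + 1)) = (j + k) + 1 := by ring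
    have e2 : 2 * (j + (k + 1)) + 1 = (2 * (j + k) + 1) + 1 + 1 := by ring
    have e3 : 2 * (k + 1) + 1 = (2 * k + 1) + 2 := by ring
    rw [e2, e1, e3]
    simp only [Nat.factorial_succ (k), Nat.factorial_succ (j+k), Nat.factorial_succ (2 * (j + k) + 1 + 1), Nat.factorial_succ (2 * (j + k) + 1)]
    have := Nat.factorial_ne_zero (2 * (j + k) + 1)
    have := Nat.factorial_ne_zero j
    push_cast
    have h4 : (2 * (j + k : ℝ) + 1 + 1) ≠ 0 := by positivity
    have h5 : (2 * (j + k : ℝ) + 1 + 1 + 1) ≠ 0 := by positivity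
    field_simp
    ring

lemma tele_series (c m : ℝ) (hc : 0 < c) (k : ℕ) :
    HasSum (fun j : ℕ => (-1) ^ j * m ^ (2 * j) / (2 * j).factorial *
        ∫ t in (-c)..c, t ^ (2 * j) * (c ^ 2 - t ^ 2) ^ k)
      (∫ t in (-c)..c, cos (m * t) * (c ^ 2 - t ^ 2) ^ k) := by
  simp_rw [← intervalIntegral.integral_const_mul]
  refine intervalIntegral.hasSum_integral_of_dominated_convergence
    (fun j _ => (m * c) ^ (2 * j) / (2 * j).factorial * (c ^ 2) ^ k) ?_ ?_ ?_ ?_ ?_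
  · intro j
    exact (by fun_prop : Continuous _).aestronglyMeasurable
  · intro j
    filter_upwards with t ht
    rw [uIoc_of_le (by linarith)] at ht
    have h1 : t ^ 2 ≤ c ^ 2 := sq_le_sq' ht.1.le ht.2
    rw [norm_mul, norm_mul, norm_div, norm_mul]
    simp only [norm_pow, norm_neg, norm_one, one_pow, one_mul, Real.norm_eq_abs, pow_mul, sq_abs, Nat.abs_cast]
    rw [abs_of_nonneg (by linarith : 0 ≤ c ^ 2 - t ^ 2), mul_pow m c, mul_pow (m^2), mul_div_right_comm, mul_assoc]
    have h2 : c ^ 2 - t ^ 2 ≤ c ^ 2 := by nlinarith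
    have h3 : 0 ≤ c ^ 2 - t ^ 2 := by linarith
    gcongr
  · filter_upwards with t _
    exact ((Real.hasSum_cosh (m * c)).summable).mul_right _
  · exact intervalIntegrable_const
  · filter_upwards with t _
    have := (Real.hasSum_cos (m * t)).mul_right ((c ^ 2 - t ^ 2) ^ k)
    refine this.congr_fun ?_ |> id
    intro j
    ring

lemma tele_double (a b : ℝ) (e : ℕ → ℝ) (he : ∀ N, 0 ≤ e N ∧ e N ≤ 1) (R : ℕ → ℝ) (S : ℝ)
    (hR : ∀ n, HasSum (fun j => a ^ n * b ^ j / (n.factorial * j.factorial) * e (n + j)) (R n))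
    (hS : HasSum (fun N => (a + b) ^ N * (e N / N.factorial)) S) : HasSum R S := by
  set F : ℕ × ℕ → ℝ := fun p =>
    a ^ p.1 * b ^ p.2 / (p.1.factorial * p.2.factorial) * e (p.1 + p.2) with hF
  have hsum : Summable F := by
    have h := (Real.summable_pow_div_factorial |a|).mul_of_nonneg
      (Real.summable_pow_div_factorial |b|) (fun n => by positivity) (fun n => by positivity)
    refine Summable.of_norm_bounded h ?_
    rintro ⟨n, j⟩
    simp only [hF, norm_mul, norm_div, norm_pow, Real.norm_eq_abs, Nat.abs_cast]
    rw [abs_of_nonneg (he _).1, div_mul_div_comm]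
    exact mul_le_of_le_one_right (by positivity) (he _).2
  have h1 : HasSum R (∑' p, F p) := hsum.hasSum.prod_fiberwise hR
  have h2 := (Finset.HasAntidiagonal.sigmaAntidiagonalEquivProd (A := ℕ)).hasSum_iff.mpr hsum.hasSum
  have h3 : HasSum (fun N => (a + b) ^ N * (e N / N.factorial)) (∑' p, F p) := by
    refine h2.sigma fun N => ?_
    have := hasSum_fintype (fun x : Finset.HasAntidiagonal.antidiagonal N => (F ∘ Finset.HasAntidiagonal.sigmaAntidiagonalEquivProd) ⟨N, x⟩)
    convert! this using 1
    rw [Finset.univ_eq_attach]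
    simp only [Function.comp, Finset.HasAntidiagonal.sigmaAntidiagonalEquivProd_apply]
    rw [Finset.sum_attach (Finset.HasAntidiagonal.antidiagonal N) F, (Commute.all a b).add_pow', Finset.sum_mul]
    refine Finset.sum_congr rfl fun p hp => ?_
    obtain rfl := Finset.HasAntidiagonal.mem_antidiagonal.mp hp
    simp only [hF, nsmul_eq_mul]
    rw [Nat.cast_add_choose]
    have := Nat.factorial_ne_zero (p.1 + p.2)
    have := Nat.factorial_ne_zero p.1
    have := Nat.factorial_ne_zero p.2
    field_simp
  rwa [h3.unique hS] at h1

lemma tele_density (c K : ℝ) (hc : 0 < c) (hK : 0 ≤ K) (k : ℕ) (g : ℝ → ℝ) :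
    ∫ t, g t ∂(volume.withDensity (fun t => ENNReal.ofReal
      (indicator (Icc (-c) c) (fun t => K * (c ^ 2 - t ^ 2) ^ k) t))) =
      K * ∫ t in (-c)..c, g t * (c ^ 2 - t ^ 2) ^ k := by
  have hmeas : Measurable (indicator (Icc (-c) c) (fun t : ℝ => K * (c ^ 2 - t ^ 2) ^ k)) :=
    (by fun_prop : Measurable (fun t : ℝ => K * (c ^ 2 - t ^ 2) ^ k)).indicator measurableSet_Icc
  rw [integral_withDensity_eq_integral_toReal_smul hmeas.ennreal_ofReal (by simp),
    intervalIntegral.integral_of_le (by linarith), ← integral_Icc_eq_integral_Ioc,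
    ← integral_const_mul, ← integral_indicator measurableSet_Icc]
  congr 1
  ext t
  by_cases ht : t ∈ Icc (-c) c
  · have h1 : t ^ 2 ≤ c ^ 2 := sq_le_sq' ht.1 ht.2
    have h3 : 0 ≤ c ^ 2 - t ^ 2 := by linarith
    rw [indicator_of_mem ht, indicator_of_mem ht, ENNReal.toReal_ofReal (by positivity), smul_eq_mul]
    ring
  · simp [indicator_of_notMem ht]

lemma tele_finite (c K : ℝ) (k : ℕ) :
    IsFiniteMeasure (volume.withDensity (fun t => ENNReal.ofReal
      (indicator (Icc (-c) c) (fun t => K * (c ^ 2 - t ^ 2) ^ k) t))) := by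
  apply isFiniteMeasure_withDensity_ofReal
  have : IntegrableOn (fun t : ℝ => K * (c ^ 2 - t ^ 2) ^ k) (Icc (-c) c) :=
    (by fun_prop : Continuous _).integrableOn_Icc
  exact ((integrable_indicator_iff measurableSet_Icc).mpr this).2

lemma tele_comb (lam x v : ℝ) (hlam : 0 < lam) (hv : 0 < v) (hx : lam ^ 2 - x ^ 2 = (lam * v) ^ 2)
    (J : ℕ → ℝ)
    (hJ : ∀ n, HasSum (fun j : ℕ => (-x ^ 2) ^ j / (n.factorial * j.factorial) *
      ((n + j).factorial / (2 * (n + j) + 1).factorial)) (J n)) :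
    HasSum (fun n => (lam ^ (2 * n + 1) + lam ^ (2 * n + 2) / (2 * n + 2)) * J n)
      (sinh (lam * v) / v + (cosh (lam * v) - cos x)) := by
  have hle : ∀ N M : ℕ, N ≤ M → 0 ≤ (N.factorial / M.factorial : ℝ) ∧
      (N.factorial / M.factorial : ℝ) ≤ 1 := by
    intro N M h
    refine ⟨by positivity, div_le_one_of_le₀ (by exact_mod_cast Nat.factorial_le h) (by positivity)⟩
  have h1 : HasSum (fun n => (lam ^ 2) ^ n * J n) (sinh (lam * v) / (lam * v)) := by
    refine tele_double (lam ^ 2) (-x ^ 2) (fun N => N.factorial / (2 * N + 1).factorial)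
      (fun N => hle _ _ (by omega)) _ _ ?_ ?_
    · intro n
      refine ((hJ n).mul_left ((lam ^ 2) ^ n)).congr_fun ?_
      intro j
      ring
    · refine ((Real.hasSum_sinh (lam * v)).div_const (lam * v)).congr_fun ?_
      intro N
      have := Nat.factorial_ne_zero N
      rw [← sub_eq_add_neg, hx, ← pow_mul]
      field_simp
      ring
  have h2 : HasSum (fun n => Nat.casesOn n (cos x)
      (fun n => lam ^ (2 * n + 2) / (2 * n + 2) * J n) : ℕ → ℝ) (cosh (lam * v)) := by
    refine tele_double (lam ^ 2) (-x ^ 2) (fun N => N.factorial / (2 * N).factorial)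
      (fun N => hle _ _ (by omega)) _ _ ?_ ?_
    · intro n
      cases n with
      | zero =>
        refine (Real.hasSum_cos x).congr_fun ?_
        intro j
        have := Nat.factorial_ne_zero j
        simp only [zero_add, pow_zero, Nat.factorial_zero, Nat.cast_one, one_mul]
        rw [neg_pow, ← pow_mul]
        field_simp
      | succ n =>
        refine ((hJ n).mul_left (lam ^ (2 * n + 2) / (2 * n + 2))).congr_fun ?_
        intro j
        have e1 : n + 1 + j = (n + j) + 1 := by ring
        have e2 : 2 * (n + j + 1) = (2 * (n + j) + 1) + 1 := by ring
        simp only [e1, e2, Nat.factorial_succ n, Nat.factorial_succ (n + j),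
          Nat.factorial_succ (2 * (n + j) + 1)]
        have := Nat.factorial_ne_zero (2 * (n + j) + 1)
        have := Nat.factorial_ne_zero j
        have := Nat.factorial_ne_zero n
        push_cast
        have h4 : (2 * (n + j : ℝ) + 1 + 1) ≠ 0 := by positivity
        have h5 : (2 * (n : ℝ) + 2) ≠ 0 := by positivity
        field_simp
        ring
    · refine (Real.hasSum_cosh (lam * v)).congr_fun ?_
      intro N
      have := Nat.factorial_ne_zero N
      rw [← sub_eq_add_neg, hx, ← pow_mul]
      field_simp
  have h3 : HasSum (fun n : ℕ => lam ^ (2 * n + 2) / (2 * n + 2) * J n)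
      (cosh (lam * v) - cos x) := by
    have := (hasSum_nat_add_iff' 1).mpr h2
    simpa using this
  have h4 := (h1.mul_left lam).add h3
  have e : lam * (sinh (lam * v) / (lam * v)) = sinh (lam * v) / v := by field_simp
  rw [e] at h4
  refine h4.congr_fun ?_
  intro n
  ring



/-- The characteristic function `E[cos mθ]` of time-integrated
symmetric two-level telegraph noise (equal probability of either initial state),
in the regime `m θ_c < λ` (i.e. `m Δ τ_c < 1`). -/
theorem telegraph_symmetric_cos_expectation_hyperbolic
    (lam θc : ℝ) (hlam : 0 < lam) (hθc : 0 < θc)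
    (d : ℕ → ℝ → ℝ)
    (hd : ∀ f : ℕ, Odd f → ∀ θ : ℝ, d f θ =
      Set.indicator (Set.Icc (-θc) θc)
        (fun θ => (Nat.factorial f : ℝ) * (θc ^ 2 - θ ^ 2) ^ ((f - 1) / 2) /
          ((2 * θc) ^ f * ((Nat.factorial ((f - 1) / 2) : ℝ)) ^ 2)) θ)
    (μ : Measure ℝ)
    (hμ : μ = (ENNReal.ofReal (Real.exp (-lam) / 2)) •
        (Measure.dirac θc + Measure.dirac (-θc)) +
      Measure.sum (fun n : ℕ =>
        volume.withDensity (fun θ => ENNReal.ofReal (Real.exp (-lam) *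
          (lam ^ (2 * n + 1) / (Nat.factorial (2 * n + 1) : ℝ) +
            lam ^ (2 * n + 2) / (Nat.factorial (2 * n + 2) : ℝ)) * d (2 * n + 1) θ))))
    (m : ℝ) (hm : 0 < m) (hmθ : m * θc < lam) :
    ∫ θ, Real.cos (m * θ) ∂μ =
      Real.exp (-lam) *
        (Real.cosh (lam * Real.sqrt (1 - (m * θc / lam) ^ 2)) +
          Real.sinh (lam * Real.sqrt (1 - (m * θc / lam) ^ 2)) /
            Real.sqrt (1 - (m * θc / lam) ^ 2)) := by
  set v := Real.sqrt (1 - (m * θc / lam) ^ 2) with hv_def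
  have hq : 0 < 1 - (m * θc / lam) ^ 2 := by
    have h1 : m * θc / lam < 1 := (div_lt_one hlam).mpr hmθ
    have h0 : 0 < m * θc / lam := by positivity
    nlinarith
  have hv : 0 < v := Real.sqrt_pos.mpr hq
  have hx : lam ^ 2 - (m * θc) ^ 2 = (lam * v) ^ 2 := by
    rw [mul_pow lam v, hv_def, Real.sq_sqrt hq.le]
    field_simp
  set K : ℕ → ℝ := fun n => Real.exp (-lam) *
    (lam ^ (2 * n + 1) / (Nat.factorial (2 * n + 1) : ℝ) +
      lam ^ (2 * n + 2) / (Nat.factorial (2 * n + 2) : ℝ)) *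
    ((2 * n + 1).factorial / ((2 * θc) ^ (2 * n + 1) * (n.factorial : ℝ) ^ 2)) with hK
  have hK0 : ∀ n, 0 ≤ K n := fun n => by simp only [hK]; positivity
  have hdens : ∀ n : ℕ, (fun θ => ENNReal.ofReal (Real.exp (-lam) *
          (lam ^ (2 * n + 1) / (Nat.factorial (2 * n + 1) : ℝ) +
            lam ^ (2 * n + 2) / (Nat.factorial (2 * n + 2) : ℝ)) * d (2 * n + 1) θ)) =
      fun θ => ENNReal.ofReal
        (indicator (Icc (-θc) θc) (fun t => K n * (θc ^ 2 - t ^ 2) ^ n) θ) := by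
    intro n
    funext θ
    congr 1
    rw [hd _ (by simp) θ]
    have e : (2 * n + 1 - 1) / 2 = n := by omega
    rw [e]
    by_cases ht : θ ∈ Icc (-θc) θc
    · rw [indicator_of_mem ht, indicator_of_mem ht]
      simp only [hK]
      ring
    · simp [indicator_of_notMem ht]
  simp only [hdens] at hμ
  -- the `n`-th coefficient
  have hKn : ∀ n, K n * (θc ^ (2 * n + 1) * 2 ^ (2 * n + 1) * (n.factorial : ℝ) ^ 2) =
      Real.exp (-lam) * (lam ^ (2 * n + 1) + lam ^ (2 * n + 2) / (2 * n + 2)) := by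
    intro n
    simp only [hK]
    rw [Nat.factorial_succ (2 * n + 1)]
    have := Nat.factorial_ne_zero (2 * n + 1)
    have := Nat.factorial_ne_zero n
    push_cast
    have h5 : (2 * (n : ℝ) + 2) ≠ 0 := by positivity
    have h6 : (2 * (n : ℝ) + 1 + 1) ≠ 0 := by positivity
    rw [mul_pow]
    field_simp
    ring
  set J : ℕ → ℝ := fun n => (∫ t in (-θc)..θc, cos (m * t) * (θc ^ 2 - t ^ 2) ^ n) /
    (θc ^ (2 * n + 1) * 2 ^ (2 * n + 1) * (n.factorial : ℝ) ^ 2) with hJdef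
  have hJ : ∀ n, HasSum (fun j : ℕ => (-(m * θc) ^ 2) ^ j / (n.factorial * j.factorial) *
      ((n + j).factorial / (2 * (n + j) + 1).factorial : ℝ)) (J n) := by
    intro n
    refine ((tele_series θc m hθc n).div_const _).congr_fun ?_
    intro j
    rw [tele_moment, neg_pow ((m * θc) ^ 2), ← pow_mul, mul_pow, add_comm j n]
    have := Nat.factorial_ne_zero (2 * (n + j) + 1)
    have := Nat.factorial_ne_zero j
    have := Nat.factorial_ne_zero (2 * j)
    have := Nat.factorial_ne_zero n
    field_simp
    ring
  have hcomb := (tele_comb lam (m * θc) v hlam hv hx J hJ).mul_left (Real.exp (-lam))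
  set ν : ℕ → Measure ℝ := fun n => volume.withDensity (fun θ => ENNReal.ofReal
        (indicator (Icc (-θc) θc) (fun t => K n * (θc ^ 2 - t ^ 2) ^ n) θ)) with hν
  have hfin : ∀ n, IsFiniteMeasure (ν n) := fun n => tele_finite θc (K n) n
  have hcosm : Continuous (fun θ : ℝ => cos (m * θ)) := by fun_prop
  have hbd : ∀ θ : ℝ, ‖cos (m * θ)‖ ≤ 1 := fun θ => Real.abs_cos_le_one _
  have hint : ∀ ρ : Measure ℝ, IsFiniteMeasure ρ → Integrable (fun θ : ℝ => cos (m * θ)) ρ :=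
    fun ρ _ => Integrable.of_bound hcosm.aestronglyMeasurable 1 (ae_of_all _ hbd)
  have hmass : ∀ n, ∫ _, (1 : ℝ) ∂(ν n) = Real.exp (-lam) *
      (lam ^ (2 * n + 1) / (Nat.factorial (2 * n + 1) : ℝ) +
        lam ^ (2 * n + 2) / (Nat.factorial (2 * n + 2) : ℝ)) := by
    intro n
    have h0 := tele_moment θc 0 n
    simp only [mul_zero, pow_zero, zero_add, Nat.factorial_zero, Nat.cast_one] at h0
    rw [hν, tele_density θc (K n) hθc (hK0 n) n, h0]
    simp only [hK]
    have := Nat.factorial_ne_zero (2 * n + 1)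
    have := Nat.factorial_ne_zero n
    rw [mul_pow]
    field_simp
  have hsumm : Integrable (fun θ : ℝ => cos (m * θ)) (Measure.sum ν) := by
    refine integrable_sum_measure (fun n => hint _ (hfin n)) ?_
    refine Summable.of_nonneg_of_le (fun n => integral_nonneg fun _ => norm_nonneg _)
      (fun n => ?_) (g := fun n => ∫ θ, ‖cos (m * θ)‖ ∂(ν n))
      (f := fun n => ∫ _, (1 : ℝ) ∂(ν n)) ?_
    · have := hfin n
      exact integral_mono (hint _ (hfin n)).norm (integrable_const _) hbd
    · simp only [hmass]
      have hs := Real.summable_pow_div_factorial lam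
      refine Summable.mul_left _ (Summable.add ?_ ?_)
      · exact hs.comp_injective (i := fun n : ℕ => 2 * n + 1) (fun a b h => by simpa using h)
      · exact hs.comp_injective (i := fun n : ℕ => 2 * n + 2) (fun a b h => by simpa using h)
  have hsum := hasSum_integral_measure hsumm
  have hval : ∫ θ, cos (m * θ) ∂(Measure.sum ν) =
      Real.exp (-lam) * (sinh (lam * v) / v + (cosh (lam * v) - cos (m * θc))) := by
    refine hsum.unique (hcomb.congr_fun ?_)
    intro n
    rw [hν, tele_density θc (K n) hθc (hK0 n) n, ← mul_assoc, ← hKn n, hJdef]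
    have := Nat.factorial_ne_zero n
    field_simp
  rw [hμ, integral_add_measure ((hint _ inferInstance).smul_measure (by simp)) hsumm, hval,
    integral_smul_measure, integral_add_measure (hint _ inferInstance) (hint _ inferInstance),
    integral_dirac, integral_dirac, ENNReal.toReal_ofReal (by positivity), mul_neg, cos_neg,
    smul_eq_mul]
  ring
end

section
/- Let λ₀, λ₁ > 0, θ_c > 0, let h(θ) = e^{λ₀ (θ - θ_c)/(2θ_c)} · e^{-λ₁ (θ + θ_c)/(2θ_c)}, and let μ_g be the Borel measure on ℝ given by μ_g = e^{-λ₁} δ_{θ_c} + Σ_{f=1}^∞ ρ_f(θ) dθ, where for odd f ≥ 1, ρ_f(θ) = h(θ) λ₁ (λ₀λ₁)^{(f-1)/2} (θ_c² - θ²)^{(f-1)/2} / ((2θ_c)^f (((f-1)/2)!)²) on [-θ_c, θ_c] (and 0 elsewhere), and for even f ≥ 2, ρ_f(θ) = h(θ) (λ₀λ₁)^{f/2} (θ_c + θ)(θ_c² - θ²)^{f/2 - 1} / ((2θ_c)^f (f/2)! ((f/2)-1)!) on [-θ_c, θ_c] (and 0 elsewhere). Then μ_g is a probability measure, i.e. μ_g(ℝ)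 = 1. -/
open MeasureTheory Real Set

namespace Telegraph

/-- Poisson weight. -/
noncomputable def pw (k : ℕ) (x : ℝ) : ℝ := Real.exp (-x) * x ^ k / (k.factorial : ℝ)

/-- Poisson cumulative weight. -/
noncomputable def cw (k : ℕ) (x : ℝ) : ℝ := ∑ j ∈ Finset.range (k + 1), pw j x

lemma pw_nonneg (k : ℕ) {x : ℝ} (hx : 0 ≤ x) : 0 ≤ pw k x := by
  unfold pw; positivity

lemma cw_succ (k : ℕ) (x : ℝ) : cw (k + 1) x = cw k x + pw (k + 1) x := by
  unfold cw; rw [Finset.sum_range_succ]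

lemma cw_zero (x : ℝ) : cw 0 x = pw 0 x := by simp [cw]

lemma pw_deriv_zero (x : ℝ) : HasDerivAt (pw 0) (-pw 0 x) x := by
  have h : HasDerivAt (fun x : ℝ => Real.exp (-x)) (Real.exp (-x) * (-1)) x :=
    (hasDerivAt_neg x).exp
  have e : pw 0 = fun x : ℝ => Real.exp (-x) := by funext y; simp [pw]
  rw [e]
  convert h using 1
  ring

lemma pw_deriv_succ (k : ℕ) (x : ℝ) : HasDerivAt (pw (k + 1)) (pw k x - pw (k + 1) x) x := by
  have h : HasDerivAt (fun x : ℝ => Real.exp (-x)) (Real.exp (-x) * (-1)) x :=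
    (hasDerivAt_neg x).exp
  have h2 := (h.mul (hasDerivAt_pow (k + 1) x)).div_const ((k + 1).factorial : ℝ)
  have e : pw (k + 1) = fun x : ℝ => Real.exp (-x) * x ^ (k + 1) / ((k + 1).factorial : ℝ) := rfl
  rw [e]
  refine h2.congr_deriv ?_
  have hk : ((k.factorial : ℕ) : ℝ) ≠ 0 := by positivity
  have hk1 : (k : ℝ) + 1 ≠ 0 := by positivity
  simp only [pw, Nat.factorial_succ]
  push_cast
  try simp only [Nat.add_sub_cancel]
  field_simp
  ring

lemma cw_deriv (k : ℕ) (x : ℝ) : HasDerivAt (cw k) (-pw k x) x := by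
  induction k with
  | zero =>
    have e : cw 0 = pw 0 := by funext y; exact cw_zero y
    rw [e]; exact pw_deriv_zero x
  | succ k ih =>
    have e : cw (k + 1) = fun y => cw k y + pw (k + 1) y := by funext y; exact cw_succ k y
    rw [e]
    refine (ih.add (pw_deriv_succ k x)).congr_deriv ?_
    ring

lemma pw_cont (k : ℕ) : Continuous (pw k) := by
  unfold pw; fun_prop

lemma cw_cont (k : ℕ) : Continuous (cw k) := by
  have := pw_cont
  unfold cw; fun_prop

lemma cw_nonneg (k : ℕ) {x : ℝ} (hx : 0 ≤ x) : 0 ≤ cw k x :=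
  Finset.sum_nonneg fun j _ => pw_nonneg j hx

lemma cw_eq (k : ℕ) (x : ℝ) :
    cw k x = Real.exp (-x) * ∑ j ∈ Finset.range (k + 1), x ^ j / (j.factorial : ℝ) := by
  unfold cw pw
  rw [Finset.mul_sum]
  exact Finset.sum_congr rfl fun j _ => by ring

lemma cw_le_one (k : ℕ) {x : ℝ} (hx : 0 ≤ x) : cw k x ≤ 1 := by
  rw [cw_eq]
  calc _ ≤ Real.exp (-x) * Real.exp x :=
        mul_le_mul_of_nonneg_left (Real.sum_le_exp_of_nonneg hx _) (Real.exp_pos _).le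
    _ = 1 := by rw [← Real.exp_add]; simp

lemma cw_tendsto (x : ℝ) : Filter.Tendsto (fun k => cw k x) Filter.atTop (nhds 1) := by
  have h1 : HasSum (fun j : ℕ => x ^ j / (j.factorial : ℝ)) (Real.exp x) := by
    rw [Real.exp_eq_exp_ℝ]; exact NormedSpace.expSeries_div_hasSum_exp x
  have h2 := ((Filter.tendsto_add_atTop_iff_nat 1).2 h1.tendsto_sum_nat).const_mul (Real.exp (-x))
  rw [← Real.exp_add, neg_add_cancel, Real.exp_zero] at h2
  exact h2.congr fun k => (cw_eq k x).symm

/-- Density of the `f + 1` flip contribution. -/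
noncomputable def r (A B c : ℝ) (f : ℕ) (t : ℝ) : ℝ :=
  if Even f then B * (pw (f / 2) (B * (t + c)) * pw (f / 2) (A * (c - t)))
  else A * (pw (f / 2 + 1) (B * (t + c)) * pw (f / 2) (A * (c - t)))

lemma r_even (A B c : ℝ) (k : ℕ) (t : ℝ) :
    r A B c (2 * k) t = B * (pw k (B * (t + c)) * pw k (A * (c - t))) := by
  have : (2 * k) / 2 = k := by omega
  simp [r, this]

lemma r_odd (A B c : ℝ) (k : ℕ) (t : ℝ) :
    r A B c (2 * k + 1) t = A * (pw (k + 1) (B * (t + c)) * pw k (A * (c - t))) := by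
  have h1 : (2 * k + 1) / 2 = k := by omega
  have h2 : ¬ Even (2 * k + 1) := by simp
  rw [r, if_neg h2, h1]

lemma r_cont (A B c : ℝ) (f : ℕ) : Continuous (r A B c f) := by
  have := pw_cont
  unfold r
  split_ifs <;> fun_prop

lemma r_nonneg {A B c : ℝ} (hA : 0 ≤ A) (hB : 0 ≤ B) (f : ℕ) {t : ℝ} (ht : t ∈ Icc (-c) c) :
    0 ≤ r A B c f t := by
  have h1 : 0 ≤ B * (t + c) := mul_nonneg hB (by linarith [ht.1])
  have h2 : 0 ≤ A * (c - t) := mul_nonneg hA (by linarith [ht.2])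
  unfold r
  split_ifs
  · exact mul_nonneg hB (mul_nonneg (pw_nonneg _ h1) (pw_nonneg _ h2))
  · exact mul_nonneg hA (mul_nonneg (pw_nonneg _ h1) (pw_nonneg _ h2))

/-- Antiderivative. -/
noncomputable def G (A B c : ℝ) (N : ℕ) (t : ℝ) : ℝ :=
  ∑ k ∈ Finset.range (N + 1), pw k (A * (c - t)) * cw k (B * (t + c))

lemma G_deriv (A B c : ℝ) (N : ℕ) (t : ℝ) :
    HasDerivAt (G A B c N) (A * (pw N (A * (c - t)) * cw N (B * (t + c)))
      - ∑ f ∈ Finset.range (2 * N + 1), r A B c f t) t := by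
  have hx : HasDerivAt (fun t => B * (t + c)) B t := by
    simpa using ((hasDerivAt_id t).add_const c).const_mul B
  have hy : HasDerivAt (fun t => A * (c - t)) (-A) t := by
    simpa using ((hasDerivAt_id t).const_sub c).const_mul A
  have hc : ∀ k, HasDerivAt (fun t => cw k (B * (t + c))) (-pw k (B * (t + c)) * B) t :=
    fun k => HasDerivAt.comp (h₂ := cw k) t (cw_deriv k (B * (t + c))) hx
  induction N with
  | zero =>
    have h0 : HasDerivAt (fun t => pw 0 (A * (c - t))) (-pw 0 (A * (c - t)) * (-A)) t :=
      HasDerivAt.comp (h₂ := pw 0) t (pw_deriv_zero (A * (c - t))) hy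
    have e : G A B c 0 = fun t => pw 0 (A * (c - t)) * cw 0 (B * (t + c)) := by
      funext s; simp [G]
    rw [e]
    refine (h0.mul (hc 0)).congr_deriv ?_
    have := r_even A B c 0 t
    simp only [mul_zero] at this
    simp only [mul_zero, zero_add, Finset.sum_range_one, this]
    ring
  | succ N ih =>
    have h0 : HasDerivAt (fun t => pw (N + 1) (A * (c - t)))
        ((pw N (A * (c - t)) - pw (N + 1) (A * (c - t))) * (-A)) t :=
      HasDerivAt.comp (h₂ := pw (N + 1)) t (pw_deriv_succ N (A * (c - t))) hy
    have e : G A B c (N + 1) = fun t => G A B c N t +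
        pw (N + 1) (A * (c - t)) * cw (N + 1) (B * (t + c)) := by
      funext s; simp only [G]; rw [Finset.sum_range_succ]
    rw [e]
    refine (ih.add (h0.mul (hc (N + 1)))).congr_deriv ?_
    have e2 : 2 * (N + 1) + 1 = 2 * N + 1 + 1 + 1 := by ring
    have e3 : 2 * N + 1 + 1 = 2 * (N + 1) := by ring
    rw [e2, Finset.sum_range_succ _ (2 * N + 1 + 1), Finset.sum_range_succ _ (2 * N + 1),
      r_odd, e3, r_even, cw_succ]
    ring

lemma pw_at_zero (k : ℕ) : pw k 0 = if k = 0 then 1 else 0 := by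
  unfold pw
  split_ifs with h
  · subst h; simp
  · simp [h]

lemma cw_at_zero (k : ℕ) : cw k 0 = 1 := by
  unfold cw
  simp [pw_at_zero]

lemma integral_partial (A B c : ℝ) (N : ℕ) :
    ∑ f ∈ Finset.range (2 * N + 1), ∫ t in (-c)..c, r A B c f t
      = cw N (A * (2 * c)) - Real.exp (-(B * (2 * c)))
        + ∫ t in (-c)..c, A * (pw N (A * (c - t)) * cw N (B * (t + c))) := by
  have hr := r_cont A B c
  have hp := pw_cont
  have hcw := cw_cont
  have hc1 : Continuous fun t => A * (pw N (A * (c - t)) * cw N (B * (t + c))) := by fun_prop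
  have hc2 : Continuous fun t => ∑ f ∈ Finset.range (2 * N + 1), r A B c f t := by fun_prop
  have key := intervalIntegral.integral_eq_sub_of_hasDerivAt (a := -c) (b := c)
    (fun t _ => G_deriv A B c N t) ((hc1.sub hc2).intervalIntegrable _ _)
  rw [intervalIntegral.integral_sub (hc1.intervalIntegrable _ _) (hc2.intervalIntegrable _ _),
    intervalIntegral.integral_finsetSum fun f _ => (hr f).intervalIntegrable _ _] at key
  have g1 : G A B c N c = Real.exp (-(B * (2 * c))) := by
    simp only [G, sub_self, mul_zero, pw_at_zero]
    simp [cw_zero, pw, two_mul]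
  have g2 : G A B c N (-c) = cw N (A * (2 * c)) := by
    simp only [G, neg_add_cancel, mul_zero, cw_at_zero, mul_one, sub_neg_eq_add, ← two_mul]
    rfl
  rw [g1, g2] at key
  linarith

lemma rem_tendsto {A B c : ℝ} (hA : 0 ≤ A) (hB : 0 ≤ B) (hc : 0 ≤ c) :
    Filter.Tendsto (fun N => ∫ t in (-c)..c, A * (pw N (A * (c - t)) * cw N (B * (t + c))))
      Filter.atTop (nhds 0) := by
  have h1 := (FloorSemiring.tendsto_pow_div_factorial_atTop (A * (2 * c))).const_mul
    (A * |c - -c|)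
  rw [mul_zero] at h1
  refine squeeze_zero_norm (fun N => ?_) h1
  have := intervalIntegral.norm_integral_le_of_norm_le_const (a := -c) (b := c)
    (f := fun t => A * (pw N (A * (c - t)) * cw N (B * (t + c))))
    (C := A * ((A * (2 * c)) ^ N / (N.factorial : ℝ))) ?_
  · refine this.trans (le_of_eq (by ring))
  · intro t ht
    rw [uIoc_of_le (by linarith)] at ht
    have hx : 0 ≤ B * (t + c) := mul_nonneg hB (by linarith [ht.1])
    have hy : 0 ≤ A * (c - t) := mul_nonneg hA (by linarith [ht.2])
    have hy2 : A * (c - t) ≤ A * (2 * c) := mul_le_mul_of_nonneg_left (by linarith [ht.1]) hA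
    rw [Real.norm_of_nonneg (mul_nonneg hA (mul_nonneg (pw_nonneg _ hy) (cw_nonneg _ hx)))]
    refine mul_le_mul_of_nonneg_left ?_ hA
    have hpw : pw N (A * (c - t)) ≤ (A * (2 * c)) ^ N / (N.factorial : ℝ) := by
      unfold pw
      refine div_le_div_of_nonneg_right ?_ (by positivity)
      calc _ ≤ 1 * (A * (c - t)) ^ N :=
            mul_le_mul_of_nonneg_right (Real.exp_le_one_iff.2 (by linarith)) (pow_nonneg hy N)
        _ ≤ _ := by rw [one_mul]; exact pow_le_pow_left₀ hy hy2 N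
    calc _ ≤ pw N (A * (c - t)) * 1 :=
          mul_le_mul_of_nonneg_left (cw_le_one _ hx) (pw_nonneg _ hy)
      _ ≤ _ := by rw [mul_one]; exact hpw

lemma int_nonneg {A B c : ℝ} (hA : 0 ≤ A) (hB : 0 ≤ B) (hc : 0 ≤ c) (f : ℕ) :
    0 ≤ ∫ t in (-c)..c, r A B c f t :=
  intervalIntegral.integral_nonneg (by linarith) fun _ ht => r_nonneg hA hB f ht

lemma int_hasSum {A B c : ℝ} (hA : 0 ≤ A) (hB : 0 ≤ B) (hc : 0 ≤ c) :
    HasSum (fun f => ∫ t in (-c)..c, r A B c f t) (1 - Real.exp (-(B * (2 * c)))) := by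
  have hn := int_nonneg hA hB hc
  rw [hasSum_iff_tendsto_nat_of_nonneg hn]
  have hm : Monotone fun n => ∑ f ∈ Finset.range n, ∫ t in (-c)..c, r A B c f t := by
    refine monotone_nat_of_le_succ fun n => ?_
    rw [Finset.sum_range_succ]
    linarith [hn n]
  have hs : Filter.Tendsto (fun N : ℕ => 2 * N + 1) Filter.atTop Filter.atTop :=
    Filter.tendsto_atTop_mono (fun n => by simp only [id]; omega) Filter.tendsto_id
  refine (tendsto_iff_tendsto_subseq_of_monotone hm hs).2 ?_
  have h := ((cw_tendsto (A * (2 * c))).sub_const (Real.exp (-(B * (2 * c))))).add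
    (rem_tendsto (A := A) (B := B) (c := c) hA hB hc)
  rw [add_zero] at h
  exact h.congr fun N => (integral_partial A B c N).symm

lemma lint_eq {A B c : ℝ} (hA : 0 ≤ A) (hB : 0 ≤ B) (hc : 0 ≤ c) (f : ℕ) :
    ∫⁻ t, ENNReal.ofReal ((Icc (-c) c).indicator (r A B c f) t)
      = ENNReal.ofReal (∫ t in (-c)..c, r A B c f t) := by
  rw [← ofReal_integral_eq_lintegral_ofReal]
  · rw [integral_indicator measurableSet_Icc, integral_Icc_eq_integral_Ioc,
      intervalIntegral.integral_of_le (by linarith)]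
  · exact ((r_cont A B c f).continuousOn.integrableOn_Icc).integrable_indicator measurableSet_Icc
  · exact Filter.Eventually.of_forall fun t => indicator_nonneg (fun s hs => r_nonneg hA hB f hs) t

end Telegraph

/-- The distribution of time-integrated two-level telegraph noise
with distinct flip rates, started in the positive state, obtained by summing over
all possible numbers of flips, is a probability measure. -/
theorem telegraph_general_measure_is_probability
    (lam0 lam1 θc : ℝ) (hlam0 : 0 < lam0) (hlam1 : 0 < lam1) (hθc : 0 < θc)
    (h : ℝ → ℝ)
    (hh : ∀ θ : ℝ, h θ =
      Real.exp (lam0 * (θ - θc) / (2 * θc)) * Real.exp (-lam1 * (θ + θc) / (2 * θc)))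
    (ρ : ℕ → ℝ → ℝ)
    (hρ_odd : ∀ f : ℕ, Odd f → ∀ θ : ℝ, ρ f θ =
      Set.indicator (Set.Icc (-θc) θc)
        (fun θ => h θ * lam1 * (lam0 * lam1) ^ ((f - 1) / 2) *
          (θc ^ 2 - θ ^ 2) ^ ((f - 1) / 2) /
          ((2 * θc) ^ f * ((Nat.factorial ((f - 1) / 2) : ℝ)) ^ 2)) θ)
    (hρ_even : ∀ f : ℕ, Even f → 2 ≤ f → ∀ θ : ℝ, ρ f θ =
      Set.indicator (Set.Icc (-θc) θc)
        (fun θ => h θ * (lam0 * lam1) ^ (f / 2) * (θc + θ) *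
          (θc ^ 2 - θ ^ 2) ^ (f / 2 - 1) /
          ((2 * θc) ^ f * (Nat.factorial (f / 2) : ℝ) *
            (Nat.factorial (f / 2 - 1) : ℝ))) θ)
    (μg : Measure ℝ)
    (hμg : μg = (ENNReal.ofReal (Real.exp (-lam1))) • Measure.dirac θc +
      Measure.sum (fun f : ℕ =>
        volume.withDensity (fun θ => ENNReal.ofReal (ρ (f + 1) θ)))) :
    μg Set.univ = 1 := by
  have hA : 0 ≤ lam0 / (2 * θc) := by positivity
  have hB : 0 ≤ lam1 / (2 * θc) := by positivity
  have hsum := Telegraph.int_hasSum hA hB hθc.le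
  have hBc : lam1 / (2 * θc) * (2 * θc) = lam1 := by field_simp
  rw [hBc] at hsum
  have hρ : ∀ f θ, ρ (f + 1) θ = (Icc (-θc) θc).indicator
      (Telegraph.r (lam0 / (2 * θc)) (lam1 / (2 * θc)) θc f) θ := by
    intro f θ
    have hexp : h θ = Real.exp (-(lam1 / (2 * θc) * (θ + θc))) *
        Real.exp (-(lam0 / (2 * θc) * (θc - θ))) := by
      rw [hh, ← Real.exp_add, ← Real.exp_add]
      congr 1
      field_simp
      ring
    have hsq : θc ^ 2 - θ ^ 2 = (θ + θc) * (θc - θ) := by ring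
    obtain ⟨k, rfl | rfl⟩ := Nat.even_or_odd' f
    · rw [hρ_odd (2 * k + 1) (by simp) θ]
      have hk : (2 * k + 1 - 1) / 2 = k := by omega
      rw [hk]
      by_cases hθ : θ ∈ Icc (-θc) θc
      · rw [indicator_of_mem hθ, indicator_of_mem hθ, Telegraph.r_even, hexp, hsq]
        unfold Telegraph.pw
        generalize Real.exp (-(lam1 / (2 * θc) * (θ + θc))) = E1
        generalize Real.exp (-(lam0 / (2 * θc) * (θc - θ))) = E2
        simp only [mul_pow, div_pow]
        field_simp
        ring
      · rw [indicator_of_notMem hθ, indicator_of_notMem hθ]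
    · rw [hρ_even (2 * k + 1 + 1) ⟨k + 1, by ring⟩ (by omega) θ]
      have hk : (2 * k + 1 + 1) / 2 = k + 1 := by omega
      rw [hk, Nat.add_sub_cancel]
      by_cases hθ : θ ∈ Icc (-θc) θc
      · rw [indicator_of_mem hθ, indicator_of_mem hθ, Telegraph.r_odd, hexp, hsq]
        unfold Telegraph.pw
        generalize Real.exp (-(lam1 / (2 * θc) * (θ + θc))) = E1
        generalize Real.exp (-(lam0 / (2 * θc) * (θc - θ))) = E2
        simp only [mul_pow, div_pow]
        field_simp
        ring
      · rw [indicator_of_notMem hθ, indicator_of_notMem hθ]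
  rw [hμg, Measure.add_apply, Measure.smul_apply, Measure.sum_apply _ MeasurableSet.univ]
  simp only [withDensity_apply _ MeasurableSet.univ, Measure.restrict_univ, hρ,
    Telegraph.lint_eq hA hB hθc.le, measure_univ, smul_eq_mul, mul_one]
  rw [← ENNReal.ofReal_tsum_of_nonneg (Telegraph.int_nonneg hA hB hθc.le) hsum.summable,
    hsum.tsum_eq, ← ENNReal.ofReal_add (Real.exp_pos _).le]
  · simp
  · have : Real.exp (-lam1) ≤ 1 := Real.exp_le_one_iff.2 (by linarith)
    linarith
end

section
/- Let θ_c > 0 be real, let c ∈ ℂ, let w ≥ 0 be real, and let u ∈ ℂ be any square root of c²θ_c² + w. Then Σ_{n=0}^∞ (w^n / ((2θ_c)^{2n+1} (n!)²)) · ∫_{-θ_c}^{θ_c} (θ_c² - θ²)^n e^{cθ} dθ = sinh(u)/u, where sinh(u)/u is understood as 1 when u = 0. -/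
open Real

theorem tel_congr {f g : ℕ → ℂ} {a : ℂ} (h : ∀ n, f n = g n) : HasSum f a ↔ HasSum g a := by
  rw [funext h]

theorem tel_moment_s12 (T : ℝ) (n : ℕ) : ∀ j : ℕ,
    ∫ θ in (-T)..T, (T ^ 2 - θ ^ 2) ^ n * θ ^ (2 * j) =
      T ^ (2 * n + 2 * j + 1) * 2 ^ (2 * n + 1) * (n.factorial : ℝ) * ((2 * j).factorial : ℝ) *
        ((n + j).factorial : ℝ) / ((j.factorial : ℝ) * ((2 * (n + j) + 1).factorial : ℝ)) := by
  induction n with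
  | zero =>
    intro j
    have h1 : (j.factorial : ℝ) ≠ 0 := by positivity
    have h2 : ((2 * j).factorial : ℝ) ≠ 0 := by positivity
    have h3 : (2 * (j : ℝ) + 1) ≠ 0 := by positivity
    have hodd : (-T) ^ (2 * j + 1) = - T ^ (2 * j + 1) := Odd.neg_pow ⟨j, rfl⟩ T
    simp only [pow_zero, one_mul, integral_pow, hodd, mul_zero, zero_add, Nat.factorial_zero,
      Nat.factorial_succ]
    push_cast
    field_simp
    ring
  | succ n ih =>
    intro j
    have e : ∀ θ : ℝ, (T ^ 2 - θ ^ 2) ^ (n + 1) * θ ^ (2 * j) =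
        T ^ 2 * ((T ^ 2 - θ ^ 2) ^ n * θ ^ (2 * j)) - (T ^ 2 - θ ^ 2) ^ n * θ ^ (2 * (j + 1)) := by
      intro θ; ring
    simp only [e]
    rw [intervalIntegral.integral_sub, intervalIntegral.integral_const_mul, ih, ih]
    · have h1 : (j.factorial : ℝ) ≠ 0 := by positivity
      have h2 : ((2 * j).factorial : ℝ) ≠ 0 := by positivity
      have h3 : ((2 * (n + j) + 1).factorial : ℝ) ≠ 0 := by positivity
      have f1 : n + 1 + j = n + j + 1 := by ring
      have f2 : n + (j + 1) = n + j + 1 := by ring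
      have f3 : 2 * (n + j + 1) + 1 = (2 * (n + j) + 1) + 1 + 1 := by ring
      have f4 : 2 * (j + 1) = 2 * j + 1 + 1 := by ring
      rw [f1, f2, f3, f4]
      simp only [Nat.factorial_succ (2 * (n + j) + 1 + 1), Nat.factorial_succ (2 * (n + j) + 1),
        Nat.factorial_succ (n + j), Nat.factorial_succ n, Nat.factorial_succ j,
        Nat.factorial_succ (2 * j + 1), Nat.factorial_succ (2 * j)]
      push_cast
      have h4 : (j : ℝ) + 1 ≠ 0 := by positivity
      have h5 : 2 * ((n : ℝ) + j) + 1 + 1 ≠ 0 := by positivity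
      have h6 : 2 * ((n : ℝ) + j) + 1 + 1 + 1 ≠ 0 := by positivity
      field_simp
      ring
    · exact Continuous.intervalIntegrable (by fun_prop) _ _
    · exact Continuous.intervalIntegrable (by fun_prop) _ _

theorem tel_cosh (T : ℝ) (c : ℂ) (n : ℕ) :
    ∫ θ in (-T)..T, ((T ^ 2 - θ ^ 2 : ℝ) ^ n : ℂ) * Complex.exp (c * θ) =
    ∫ θ in (-T)..T, ((T ^ 2 - θ ^ 2 : ℝ) ^ n : ℂ) * Complex.cosh (c * θ) := by
  have h := intervalIntegral.integral_comp_neg (a := -T) (b := T)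
    (fun θ : ℝ => ((T ^ 2 - θ ^ 2 : ℝ) ^ n : ℂ) * Complex.exp (c * θ))
  rw [neg_neg] at h
  have e : ∀ θ : ℝ, ((T ^ 2 - θ ^ 2 : ℝ) ^ n : ℂ) * Complex.cosh (c * θ) =
    (1 / 2 : ℂ) * (((T ^ 2 - θ ^ 2 : ℝ) ^ n : ℂ) * Complex.exp (c * θ) +
      ((T ^ 2 - (-θ) ^ 2 : ℝ) ^ n : ℂ) * Complex.exp (c * (-θ : ℝ))) := by
    intro θ
    rw [Complex.cosh]
    push_cast
    rw [neg_sq, mul_neg]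
    ring
  simp only [e]
  rw [intervalIntegral.integral_const_mul, intervalIntegral.integral_add, h]
  · ring
  · exact Continuous.intervalIntegrable (by fun_prop) _ _
  · exact Continuous.intervalIntegrable (by fun_prop) _ _

theorem tel_series (T : ℝ) (hT : 0 < T) (c : ℂ) (n : ℕ) :
    HasSum (fun j : ℕ => (c ^ (2 * j) / ((2 * j).factorial : ℂ)) *
        ((∫ θ in (-T)..T, (T ^ 2 - θ ^ 2) ^ n * θ ^ (2 * j) : ℝ) : ℂ))
      (∫ θ in (-T)..T, ((T ^ 2 - θ ^ 2 : ℝ) ^ n : ℂ) * Complex.exp (c * θ)) := by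
  rw [tel_cosh]
  have key := intervalIntegral.hasSum_integral_of_dominated_convergence
    (μ := MeasureTheory.volume) (a := -T) (b := T)
    (F := fun (j : ℕ) (θ : ℝ) => ((T ^ 2 - θ ^ 2 : ℝ) ^ n : ℂ) *
      ((c * θ) ^ (2 * j) / ((2 * j).factorial : ℂ)))
    (f := fun θ : ℝ => ((T ^ 2 - θ ^ 2 : ℝ) ^ n : ℂ) * Complex.cosh (c * θ))
    (fun j _ => (T ^ 2) ^ n * ((‖c‖ * T) ^ (2 * j) / ((2 * j).factorial : ℝ)))
    (fun j => Continuous.aestronglyMeasurable (by fun_prop))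
    (fun j => Filter.Eventually.of_forall fun θ hθ => by
      rw [Set.uIoc_of_le (by linarith)] at hθ
      have h1 : |θ| ≤ T := abs_le.2 ⟨hθ.1.le, hθ.2⟩
      have h2 : θ ^ 2 ≤ T ^ 2 := sq_le_sq' hθ.1.le hθ.2
      have h3 : |T ^ 2 - θ ^ 2| ≤ T ^ 2 := by
        rw [abs_of_nonneg (by linarith)]; nlinarith [sq_nonneg θ]
      rw [norm_mul, norm_div, norm_pow, norm_pow, norm_mul, Complex.norm_real, Complex.norm_real,
        Complex.norm_natCast, Real.norm_eq_abs, Real.norm_eq_abs]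
      gcongr)
    (Filter.Eventually.of_forall fun θ _ =>
      ((Real.hasSum_cosh (‖c‖ * T)).summable.mul_left _))
    (by simp)
    (Filter.Eventually.of_forall fun θ _ => (Complex.hasSum_cosh (c * θ)).mul_left _)
  refine (tel_congr fun j => ?_).2 key
  rw [← intervalIntegral.integral_ofReal, ← intervalIntegral.integral_const_mul]
  congr 1
  funext θ
  push_cast
  ring

theorem telegraph_odd_flip_sum
    (θc : ℝ) (hθc : 0 < θc) (c : ℂ) (w : ℝ) (hw : 0 ≤ w) (u : ℂ)
    (hu : u ^ 2 = c ^ 2 * (θc : ℂ) ^ 2 + (w : ℂ)) :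
    ∑' n : ℕ, ((w ^ n / ((2 * θc) ^ (2 * n + 1) * ((Nat.factorial n : ℝ)) ^ 2) : ℝ) : ℂ) *
      ∫ θ in (-θc)..θc, ((θc ^ 2 - θ ^ 2 : ℝ) ^ n : ℂ) * Complex.exp (c * θ) =
    if u = 0 then 1 else Complex.sinh u / u := by
  let a : ℂ := c ^ 2 * (θc : ℂ) ^ 2
  let F : ℕ × ℕ → ℂ := fun p => (w : ℂ) ^ p.1 * a ^ p.2 *
    ((p.1 + p.2).factorial / (p.1.factorial * p.2.factorial * (2 * (p.1 + p.2) + 1).factorial))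
  have hF : Summable F := by
    have hs := Summable.mul_of_nonneg (Real.summable_pow_div_factorial w)
      (Real.summable_pow_div_factorial ‖a‖) (fun n => by positivity) (fun n => by positivity)
    refine Summable.of_norm_bounded hs ?_
    rintro ⟨n, j⟩
    have hle : ((n + j).factorial : ℝ) ≤ ((2 * (n + j) + 1).factorial : ℝ) := by
      exact_mod_cast Nat.factorial_le (by omega)
    simp only [F, norm_mul, norm_div, norm_pow, Complex.norm_natCast, Complex.norm_real,
      Real.norm_eq_abs, abs_of_nonneg hw]
    have : ((n + j).factorial : ℝ) / (n.factorial * j.factorial * (2 * (n + j) + 1).factorial)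
        ≤ 1 / (n.factorial * j.factorial) := by
      rw [div_le_div_iff₀ (by positivity) (by positivity)]
      have : (0:ℝ) ≤ n.factorial * j.factorial := by positivity
      nlinarith
    calc _ ≤ w ^ n * ‖a‖ ^ j * (1 / (n.factorial * j.factorial) : ℝ) := by gcongr
      _ = _ := by field_simp
  have hrow : ∀ n : ℕ, HasSum (fun j => F (n, j))
      (((w ^ n / ((2 * θc) ^ (2 * n + 1) * ((Nat.factorial n : ℝ)) ^ 2) : ℝ) : ℂ) *
      ∫ θ in (-θc)..θc, ((θc ^ 2 - θ ^ 2 : ℝ) ^ n : ℂ) * Complex.exp (c * θ)) := by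
    intro n
    have h := (tel_series θc hθc c n).mul_left
      (((w ^ n / ((2 * θc) ^ (2 * n + 1) * ((Nat.factorial n : ℝ)) ^ 2) : ℝ) : ℂ))
    refine (tel_congr fun j => ?_).2 h
    rw [tel_moment_s12]
    have h1 : (j.factorial : ℂ) ≠ 0 := by exact_mod_cast j.factorial_ne_zero
    have h2 : ((2 * j).factorial : ℂ) ≠ 0 := by exact_mod_cast (2 * j).factorial_ne_zero
    have h3 : ((2 * (n + j) + 1).factorial : ℂ) ≠ 0 := by
      exact_mod_cast (2 * (n + j) + 1).factorial_ne_zero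
    have h4 : (n.factorial : ℂ) ≠ 0 := by exact_mod_cast n.factorial_ne_zero
    have h5 : (θc : ℂ) ≠ 0 := by exact_mod_cast hθc.ne'
    simp only [F, a]
    push_cast
    field_simp
    ring
  rw [(hF.hasSum.prod_fiberwise hrow).tsum_eq]
  have hd : HasSum (fun N : ℕ => u ^ (2 * N) / ((2 * N + 1).factorial : ℂ)) (∑' p, F p) := by
    have h := (Equiv.hasSum_iff (f := F) (Finset.HasAntidiagonal.sigmaAntidiagonalEquivProd (A := ℕ))).2 hF.hasSum
    have h2 := h.sigma (fun N => hasSum_fintype _)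
    refine (tel_congr fun N => ?_).2 h2
    rw [pow_mul, hu, add_comm, (Commute.all _ _).add_pow']
    rw [Finset.univ_eq_attach]
    simp only [Function.comp, Finset.HasAntidiagonal.sigmaAntidiagonalEquivProd_apply]
    rw [Finset.sum_attach (Finset.HasAntidiagonal.antidiagonal N) F, Finset.sum_div]
    refine Finset.sum_congr rfl fun p hp => ?_
    rw [Finset.HasAntidiagonal.mem_antidiagonal] at hp
    subst hp
    rw [Nat.choose_symm_add, Nat.add_choose, nsmul_eq_mul, Nat.cast_div (Nat.factorial_mul_factorial_dvd_factorial_add _ _)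
      (by exact_mod_cast mul_ne_zero (Nat.factorial_ne_zero _) (Nat.factorial_ne_zero _))]
    simp only [F, a]
    push_cast
    field_simp
  split_ifs with h0
  · refine hd.unique ?_
    convert hasSum_single (f := fun N : ℕ => u ^ (2 * N) / ((2 * N + 1).factorial : ℂ)) 0 ?_ using 1
    · simp
    · intro N hN
      simp [h0, hN]
  · refine hd.unique ?_
    refine (tel_congr fun N => ?_).2 ((Complex.hasSum_sinh u).div_const u)
    field_simp
    rw [pow_succ]
end

section
/- Define the Carlitz Bessel polynomials by p_0(x) = 1 and, for n ≥ 1, p_n(x) = Σ_{k=1}^{n} ((2n-k-1)! / ((k-1)! (n-k)! 2^{n-k})) x^k. Then for every integer n ≥ 0 and every real x ≠ 0, p_{n+1}'(x) - p_{n+1}(x)·(1 + 1/x) + x · p_n(x) = 0. -/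
open Real Finset

/-- The Carlitz Bessel polynomials (as real functions):
`p_0(x) = 1` and `p_n(x) = Σ_{k=1}^n ((2n-k-1)!/((k-1)!(n-k)! 2^{n-k})) x^k` for `n ≥ 1`. -/
noncomputable def carlitzBesselP (n : ℕ) (x : ℝ) : ℝ :=
  if n = 0 then 1 else
    ∑ k ∈ Finset.Icc 1 n,
      ((Nat.factorial (2 * n - k - 1) : ℝ) /
        ((Nat.factorial (k - 1) : ℝ) * (Nat.factorial (n - k) : ℝ) * 2 ^ (n - k))) * x ^ k

/-- coefficient of `x^(j+1)` in `p_(n+1)` -/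
noncomputable def cbC (n j : ℕ) : ℝ :=
  (Nat.factorial (2 * n - j) : ℝ) /
    ((Nat.factorial j : ℝ) * (Nat.factorial (n - j) : ℝ) * 2 ^ (n - j))

lemma cbP_succ (n : ℕ) (x : ℝ) :
    carlitzBesselP (n + 1) x = ∑ j ∈ Finset.range (n + 1), cbC n j * x ^ (j + 1) := by
  unfold carlitzBesselP
  have hh := Finset.sum_Ico_add' (fun k => cbC n (k - 1) * x ^ k) 0 (n + 1) 1
  simp only [Nat.add_sub_cancel] at hh
  rw [if_neg (Nat.succ_ne_zero n), Finset.range_eq_Ico, hh]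
  apply Finset.sum_congr
  · ext k
    simp only [Finset.mem_Icc, Finset.mem_Ico]
    omega
  · intro k hk
    simp only [Finset.mem_Ico] at hk
    obtain ⟨j, rfl⟩ : ∃ j, k = j + 1 := ⟨k - 1, by omega⟩
    have h1 : 2 * (n + 1) - (j + 1) - 1 = 2 * n - j := by omega
    have h2 : n + 1 - (j + 1) = n - j := by omega
    simp only [cbC, h1, h2, Nat.add_sub_cancel]

lemma cbC_self (n : ℕ) : cbC n n = 1 := by
  have h : 2 * n - n = n := by omega
  have := Nat.factorial_ne_zero n
  simp [cbC, h, this]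

lemma cbC_one (m : ℕ) : cbC (m + 1) 1 = cbC (m + 1) 0 := by
  have h1 : 2 * (m + 1) - 1 = 2 * m + 1 := by omega
  have h2 : 2 * (m + 1) - 0 = (2 * m + 1) + 1 := by omega
  have h3 : m + 1 - 0 = m + 1 := rfl
  have := Nat.factorial_ne_zero m
  simp only [cbC, h1, h2, h3, Nat.add_sub_cancel, Nat.factorial_succ (2 * m + 1),
    Nat.factorial_succ m, pow_succ, Nat.factorial_zero, Nat.factorial_one]
  push_cast
  field_simp
  ring

lemma cbC_rec (m i : ℕ) (h : i < m) :
    ((i : ℝ) + 2) * cbC (m + 1) (i + 2) - cbC (m + 1) (i + 1) + cbC m i = 0 := by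
  obtain ⟨d, rfl⟩ : ∃ d, m = i + 1 + d := ⟨m - (i + 1), by omega⟩
  have h1 : 2 * (i + 1 + d + 1) - (i + 2) = i + 2 * d + 2 := by omega
  have h2 : 2 * (i + 1 + d + 1) - (i + 1) = (i + 2 * d + 2) + 1 := by omega
  have h3 : 2 * (i + 1 + d) - i = i + 2 * d + 2 := by omega
  have h4 : i + 1 + d + 1 - (i + 2) = d := by omega
  have h5 : i + 1 + d + 1 - (i + 1) = d + 1 := by omega
  have h6 : i + 1 + d - i = d + 1 := by omega
  have := Nat.factorial_ne_zero d
  have := Nat.factorial_ne_zero i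
  simp only [cbC, h1, h2, h3, h4, h5, h6, Nat.factorial_succ (i + 2 * d + 2),
    Nat.factorial_succ d, Nat.factorial_succ (i + 1), Nat.factorial_succ i, pow_succ]
  push_cast
  have e : (i : ℝ) + 1 + 1 ≠ 0 := by positivity
  field_simp
  ring

/-- The Carlitz Bessel polynomials satisfy the differential
equation `p_{n+1}'(x) - p_{n+1}(x)(1 + 1/x) + x p_n(x) = 0` for `x ≠ 0`. -/
theorem carlitzBesselP_differential_equation
    (n : ℕ) (x : ℝ) (hx : x ≠ 0) :
    deriv (carlitzBesselP (n + 1)) x -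
      carlitzBesselP (n + 1) x * (1 + 1 / x) + x * carlitzBesselP n x = 0 := by
  have hd : deriv (carlitzBesselP (n + 1)) x =
      ∑ j ∈ Finset.range (n + 1), cbC n j * (((j : ℝ) + 1) * x ^ j) := by
    rw [funext (cbP_succ n)]
    apply HasDerivAt.deriv
    apply HasDerivAt.fun_sum
    intro j _
    have := (hasDerivAt_pow (j + 1) x).const_mul (cbC n j)
    simpa using this
  have hs : deriv (carlitzBesselP (n + 1)) x - carlitzBesselP (n + 1) x * (1 / x) =
      ∑ j ∈ Finset.range n, cbC n (j + 1) * (((j : ℝ) + 1) * x ^ (j + 1)) := by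
    rw [hd, cbP_succ, Finset.sum_mul, ← Finset.sum_sub_distrib, Finset.sum_range_succ']
    have h0 : cbC n 0 * (((0 : ℕ) : ℝ) + 1) * x ^ 0 - cbC n 0 * x ^ (0 + 1) * (1 / x) = 0 := by
      field_simp
      simp
    rw [← mul_assoc (cbC n 0), h0, add_zero]
    apply Finset.sum_congr rfl
    intro j _
    push_cast
    field_simp
    ring
  have key : deriv (carlitzBesselP (n + 1)) x -
      carlitzBesselP (n + 1) x * (1 + 1 / x) + x * carlitzBesselP n x =
      (deriv (carlitzBesselP (n + 1)) x - carlitzBesselP (n + 1) x * (1 / x))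
      - carlitzBesselP (n + 1) x + x * carlitzBesselP n x := by ring
  rw [key, hs]
  cases n with
  | zero => simp [cbP_succ, cbC_self, carlitzBesselP]
  | succ m =>
    have hz : ∑ i ∈ Finset.range m, (((i : ℝ) + 2) * cbC (m + 1) (i + 2) - cbC (m + 1) (i + 1)
        + cbC m i) * x ^ (i + 2) = 0 := by
      apply Finset.sum_eq_zero
      intro i hi
      rw [cbC_rec m i (Finset.mem_range.mp hi), zero_mul]
    rw [cbP_succ, cbP_succ, Finset.sum_range_succ', Finset.sum_range_succ,
      Finset.sum_range_succ' _ m, Finset.sum_range_succ _ m, cbC_self, cbC_self, mul_add,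
      Finset.mul_sum]
    simp only [add_mul, sub_mul, Finset.sum_add_distrib, Finset.sum_sub_distrib] at hz
    simp only [zero_add, cbC_one]
    rw [← Finset.sum_add_distrib] at hz
    have e1 : ∑ k ∈ Finset.range m, cbC (m + 1) (k + 1 + 1) * ((((k + 1 : ℕ) : ℝ) + 1) * x ^ (k + 1 + 1))
        = ∑ i ∈ Finset.range m, ((i : ℝ) * cbC (m + 1) (i + 2) * x ^ (i + 2)
          + 2 * cbC (m + 1) (i + 2) * x ^ (i + 2)) := by
      apply Finset.sum_congr rfl
      intro i _
      push_cast
      ring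
    have e2 : ∑ i ∈ Finset.range m, x * (cbC m i * x ^ (i + 1))
        = ∑ i ∈ Finset.range m, cbC m i * x ^ (i + 2) := by
      apply Finset.sum_congr rfl
      intro i _
      ring
    rw [e1, e2]
    push_cast
    linear_combination hz
end
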